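/- arXiv:math/0612382 — 5 statements merged into one kernel-verified Lean document; each statement's English description precedes it below -/
import Mathlib

section
/- Theorem 2.5. Let {Q_n}_{n≥0} satisfy Assumption 2.1, let the kernels {Ḡ_n}_{n≥0} satisfy Assumption 2.2, and let the operators (T_n u)(x) = (Ḡ_n ⊛ Q_n(u))(x) = −∫_ℝ Ḡ_n(y, x−y) dQ_n(u(y)) satisfy Assumption 2.4. Let {F_n}_{n≥0} be distribution functions with F₀(x) = 1_{x ≥ 0}, F̄_n = 1 − F_n, and F̄_{n+1} = T_n F̄_n. Then the sequence of recentered distribution functions {F_n^s}_{n≥0} is tight after centering. -/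
open MeasureTheory Filter Set

/-- `MemD u` : `u` belongs to the class `𝒟`, i.e. `u` is nonincreasing, right-continuous,
`[0,1]`-valued, with `u → 1` at `-∞` and `u → 0` at `+∞` (so `1 - u` is a distribution
function). -/
def MemD (u : ℝ → ℝ) : Prop :=
  Antitone u ∧ (∀ x, ContinuousWithinAt u (Set.Ici x) x) ∧
    (∀ x, u x ∈ Set.Icc (0 : ℝ) 1) ∧
    Filter.Tendsto u Filter.atBot (nhds 1) ∧ Filter.Tendsto u Filter.atTop (nhds 0)

open Classical in
/-- The Lebesgue–Stieltjes measure `d(1-u) = -du` associated with a nonincreasing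
right-continuous function `u` (junk value `0` if `u` is not of this form). -/
noncomputable def lsMeasure (u : ℝ → ℝ) : MeasureTheory.Measure ℝ :=
  if h : Monotone (fun x => 1 - u x) ∧
      ∀ x, ContinuousWithinAt (fun x => 1 - u x) (Set.Ici x) x then
    StieltjesFunction.measure ⟨fun x => 1 - u x, h.1, h.2⟩
  else 0

/-- The convolution operation `(Ḡ ⊛ u)(x) = -∫ Ḡ(y, x - y) du(y)`. -/
noncomputable def convD (G : ℝ → ℝ → ℝ) (u : ℝ → ℝ) (x : ℝ) : ℝ :=
  ∫ y, G y (x - y) ∂(lsMeasure u)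

/-- The median `Med(F) = inf {x : F(x) ≥ 1/2}` of a distribution function. -/
noncomputable def Med (F : ℝ → ℝ) : ℝ := sInf {x | 1 / 2 ≤ F x}

/-- Tightness of the recentered distribution functions `Fₙˢ(x) = Fₙ(x + Med(Fₙ))`:
for every `ε > 0` there is `A > 0` with `Fₙˢ(A) - Fₙˢ(-A) > 1 - ε` for all `n`. -/
def TightAfterCentering (F : ℕ → ℝ → ℝ) : Prop :=
  ∀ ε : ℝ, 0 < ε → ∃ A : ℝ, 0 < A ∧
    ∀ n, 1 - ε < F n (A + Med (F n)) - F n (-A + Med (F n))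

/-- Assumption 2.1 on `{Qₙ}` with constants `δ₀, m, c*, θ*`. -/
def Assumption21 (Q : ℕ → ℝ → ℝ) (δ₀ m cs θs : ℝ) : Prop :=
  0 < δ₀ ∧ 1 < m ∧ m ≤ 2 ∧ 0 < cs ∧ 0 < θs ∧
  (∀ n, MonotoneOn (Q n) (Set.Icc 0 1)) ∧
  (∀ n, Set.MapsTo (Q n) (Set.Icc 0 1) (Set.Icc 0 1)) ∧
  (∀ n, Q n 0 = 0) ∧ (∀ n, Q n 1 = 1) ∧
  (∀ n, ∀ x : ℝ, 0 ≤ x → x ≤ 2 * δ₀ → m * x ≤ Q n x) ∧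
  (∀ n, ∀ x₁ x₂ : ℝ, 0 < x₁ → x₁ < x₂ → x₂ ≤ 2 * min δ₀ x₁ →
    x₂ / x₁ ≤ (Q n x₂ / Q n x₁) * (1 + cs * (Q n x₁) ^ θs))

/-- Assumption 2.2 on the kernels `{Ḡₙ}` with constants `a, M₀, ε₀`:
`Ḡₙ(y,·) ∈ 𝒟`, the monotonicity condition (G1), the exponential-tail condition (G2)
and the centering condition (G3). -/
def Assumption22 (G : ℕ → ℝ → ℝ → ℝ) (a M₀ ε₀ : ℝ) : Prop :=
  0 < a ∧ a < 1 ∧ 0 < M₀ ∧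
  (∀ n y, MemD (G n y)) ∧
  (∀ n x, Monotone (fun y => G n y (x - y))) ∧
  (∀ n x, Antitone (fun y => G n y x)) ∧
  (∀ n, ∀ y x M : ℝ, 0 ≤ x → M₀ ≤ M →
    G n (y - M) (x + M) ≤ Real.exp (-(a * M)) * G n y x) ∧
  (∀ n y, 1 - ε₀ ≤ G n y 0)

/-- Membership in the class `𝒬̃` of Definition 2.3: strictly increasing continuous
`Q̃ : [0,1] → [0,1]` with `Q̃(0) = 0`, `Q̃(1) = 1`, satisfying (T1) and (T2). -/
def MemQt (Qt : ℝ → ℝ) : Prop :=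
  StrictMonoOn Qt (Set.Icc 0 1) ∧ ContinuousOn Qt (Set.Icc 0 1) ∧
  Set.MapsTo Qt (Set.Icc 0 1) (Set.Icc 0 1) ∧ Qt 0 = 0 ∧ Qt 1 = 1 ∧
  (∀ x : ℝ, 0 < x → x < 1 → x < Qt x) ∧
  (∀ δ : ℝ, 0 < δ → ∃ c : ℝ, 1 < c ∧ ∀ x : ℝ, 0 < x → x ≤ 1 - δ → c * x < Qt x) ∧
  (∀ δ : ℝ, 0 < δ → δ < 1 → ∃ g : ℝ → ℝ, (∀ ε, 0 ≤ g ε) ∧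
    Filter.Tendsto g (nhdsWithin 0 (Set.Ioi 0)) (nhds 0) ∧
    ∀ ε x : ℝ, 0 < ε → δ ≤ x → x ≤ 1 → Qt x ≤ (1 - δ) / (1 + ε) →
      (1 + ε) * Qt x ≤ Qt ((1 + g ε) * x))

open Topology

/-- `u` gains a factor `1 + ε` over each backward shift by `M`, up to an error of higher order
in `u`. -/
def GrowthBound (ε M β K : ℝ) (u : ℝ → ℝ) : Prop :=
  ∀ y, (1 + ε) * u y ≤ u (y - M) + K * u y ^ (1 + β)

lemma MemD.exists_stieltjes {v : ℝ → ℝ} (hv : MemD v) :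
    ∃ f : StieltjesFunction ℝ, (∀ x, f x = 1 - v x) ∧ lsMeasure v = f.measure := by
  have h : Monotone (fun x => 1 - v x) ∧
      ∀ x, ContinuousWithinAt (fun x => 1 - v x) (Set.Ici x) x :=
    ⟨fun a b hab => sub_le_sub_left (hv.1 hab) 1, fun x => (hv.2.1 x).const_sub 1⟩
  refine ⟨⟨fun x => 1 - v x, h.1, h.2⟩, fun x => rfl, ?_⟩
  rw [lsMeasure, dif_pos h]

lemma MemD.isProbabilityMeasure {v : ℝ → ℝ} (hv : MemD v) :
    IsProbabilityMeasure (lsMeasure v) := by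
  obtain ⟨f, hf, hμ⟩ := hv.exists_stieltjes
  have hf' : (f : ℝ → ℝ) = fun x => 1 - v x := funext hf
  constructor
  rw [hμ, f.measure_univ (l := 0) (u := 1)]
  · simp
  · rw [hf']; simpa using hv.2.2.2.1.const_sub 1
  · rw [hf']; simpa using hv.2.2.2.2.const_sub 1

lemma MemD.measureReal_Ioi {v : ℝ → ℝ} (hv : MemD v) (y : ℝ) :
    (lsMeasure v).real (Ioi y) = v y := by
  obtain ⟨f, hf, hμ⟩ := hv.exists_stieltjes
  have hf' : (f : ℝ → ℝ) = fun x => 1 - v x := funext hf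
  rw [Measure.real, hμ, f.measure_Ioi (l := 1), hf, sub_sub_cancel,
    ENNReal.toReal_ofReal (hv.2.2.1 y).1]
  rw [hf']; simpa using hv.2.2.2.2.const_sub 1

lemma MemD.tendsto_measureReal_Ici {v : ℝ → ℝ} (hv : MemD v) (y : ℝ) :
    Tendsto v (𝓝[<] y) (𝓝 ((lsMeasure v).real (Ici y))) := by
  obtain ⟨f, hf, hμ⟩ := hv.exists_stieltjes
  have hf' : (f : ℝ → ℝ) = fun x => 1 - v x := funext hf
  have h1 : Tendsto f (𝓝[<] y) (𝓝 (Function.leftLim f y)) := f.mono.tendsto_leftLim y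
  have h2 : Function.leftLim f y ≤ 1 :=
    le_of_tendsto h1 (Eventually.of_forall fun x => by
      rw [hf]; linarith [(hv.2.2.1 x).1])
  rw [Measure.real, hμ, f.measure_Ici (l := 1), ENNReal.toReal_ofReal (by linarith)]
  · have := h1.const_sub 1
    refine this.congr fun x => ?_
    rw [hf]; ring
  · rw [hf']; simpa using hv.2.2.2.2.const_sub 1

/-- Upper sets of `ℝ` are rays. -/
lemma isUpperSet_real_cases {S : Set ℝ} (hS : IsUpperSet S) :
    S = ∅ ∨ S = univ ∨ (∃ s, S = Ici s) ∨ ∃ s, S = Ioi s := by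
  rcases S.eq_empty_or_nonempty with h | hne
  · exact Or.inl h
  by_cases hb : BddBelow S
  · refine Or.inr (Or.inr ?_)
    by_cases hm : sInf S ∈ S
    · exact Or.inl ⟨sInf S, Subset.antisymm (fun y hy => csInf_le hb hy)
        (fun y hy => hS hy hm)⟩
    · refine Or.inr ⟨sInf S, Subset.antisymm (fun y hy => ?_) (fun y hy => ?_)⟩
      · exact lt_of_le_of_ne (csInf_le hb hy) (fun h => hm (h ▸ hy))
      · obtain ⟨z, hz, hzy⟩ := exists_lt_of_csInf_lt hne hy
        exact hS hzy.le hz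
  · refine Or.inr (Or.inl (eq_univ_of_forall fun y => ?_))
    by_contra hy
    exact hb ⟨y, fun z hz => le_of_not_gt fun hzy => hy (hS hzy.le hz)⟩

/-- A growth bound for `v` extends to all upper sets. -/
lemma GrowthBound.upperSet {ε M β K : ℝ} {v : ℝ → ℝ} (h : GrowthBound ε M β K v)
    (hv : MemD v) (hβ : 0 < β) (hK : ε ≤ K) {S : Set ℝ} (hS : IsUpperSet S) :
    (1 + ε) * (lsMeasure v).real S ≤
      (lsMeasure v).real {y | y + M ∈ S} + K * (lsMeasure v).real S ^ (1 + β) := by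
  have := hv.isProbabilityMeasure
  rcases isUpperSet_real_cases hS with rfl | rfl | ⟨s, rfl⟩ | ⟨s, rfl⟩
  · have : (1 + β) ≠ 0 := by linarith
    simp [Real.zero_rpow this]
  · simp; linarith
  · have e : {y | y + M ∈ Ici s} = Ici (s - M) := by
      ext y; simp
    rw [e]
    have l1 := hv.tendsto_measureReal_Ici s
    have l2 := hv.tendsto_measureReal_Ici (s - M)
    have l3 : Tendsto (fun y => y - M) (𝓝[<] s) (𝓝[<] (s - M)) := by
      refine tendsto_nhdsWithin_iff.2 ⟨?_, ?_⟩
      · exact ((continuous_id.sub continuous_const).tendsto s).mono_left nhdsWithin_le_nhds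
      · filter_upwards [self_mem_nhdsWithin] with y hy
        simpa using hy
    have l4 := l1.rpow_const (p := 1 + β) (Or.inr (by linarith))
    exact le_of_tendsto_of_tendsto' (l1.const_mul (1 + ε)) ((l2.comp l3).add (l4.const_mul K)) h
  · have e : {y | y + M ∈ Ioi s} = Ioi (s - M) := by
      ext y; simp [sub_lt_iff_lt_add]
    rw [e, hv.measureReal_Ioi, hv.measureReal_Ioi]
    exact h s

lemma rpow_one_add_of_nonneg {x β : ℝ} (hx : 0 ≤ x) (hβ : 0 < β) :
    x ^ (1 + β) = x * x ^ β := by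
  rw [Real.rpow_add' hx (by linarith), Real.rpow_one]

/-- Applying a branching mechanism `q` improves the constant in a growth bound. -/
lemma growth_branching {q : ℝ → ℝ} {δ₀ m c θ β ε K K' p p' : ℝ}
    (hδ : 0 < δ₀) (hm : 1 < m) (hc : 0 < c) (hβ : 0 < β) (hβθ : β ≤ θ)
    (hε : 0 < ε) (hε1 : ε ≤ 1)
    (hmono : MonotoneOn q (Icc 0 1)) (hmaps : MapsTo q (Icc 0 1) (Icc 0 1))
    (hexp : ∀ x : ℝ, 0 ≤ x → x ≤ 2 * δ₀ → m * x ≤ q x)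
    (hratio : ∀ x₁ x₂ : ℝ, 0 < x₁ → x₁ < x₂ → x₂ ≤ 2 * min δ₀ x₁ →
      x₂ / x₁ ≤ (q x₂ / q x₁) * (1 + c * (q x₁) ^ θ))
    (hK : 0 ≤ K) (hKK : K / m ^ β + 2 * c ≤ K') (hK' : ε ≤ K' * δ₀ ^ β)
    (hp : p ∈ Icc (0 : ℝ) 1) (hp' : p' ∈ Icc (0 : ℝ) 1) (hpp : p ≤ p')
    (hzero : q 0 = 0)
    (h : (1 + ε) * p ≤ p' + K * p ^ (1 + β)) :
    (1 + ε) * q p ≤ q p' + K' * q p ^ (1 + β) := by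
  have hs := hmaps hp
  have hss : q p ≤ q p' := hmono hp hp' hpp
  have hmβ : 0 < m ^ β := Real.rpow_pos_of_pos (by linarith) _
  have hK'0 : 0 ≤ K' := le_trans (by positivity) hKK
  rw [rpow_one_add_of_nonneg hs.1 hβ]
  rcases hs.1.eq_or_lt with h0 | h0
  · rw [← h0] at hss ⊢; simpa using hss
  have hp0 : 0 < p := hp.1.lt_of_ne (by rintro rfl; rw [hzero] at h0; exact lt_irrefl _ h0)
  have key : ε ≤ K' * q p ^ β → (1 + ε) * q p ≤ q p' + K' * (q p * q p ^ β) := by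
    intro hh
    nlinarith [mul_le_mul_of_nonneg_right hh hs.1]
  rcases lt_or_ge δ₀ p with hlt | hle
  · apply key
    refine hK'.trans (mul_le_mul_of_nonneg_left (Real.rpow_le_rpow hδ.le ?_ hβ.le) hK'0)
    have h1 := hexp δ₀ hδ.le (by linarith)
    have h2 := hmono ⟨hδ.le, hlt.le.trans hp.2⟩ hp hlt.le
    nlinarith
  have hmp : m * p ≤ q p := hexp p hp.1 (by linarith)
  have hpow : K * p ^ β ≤ K / m ^ β * q p ^ β := by
    have : (m * p) ^ β ≤ q p ^ β := Real.rpow_le_rpow (by positivity) hmp hβ.le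
    rw [Real.mul_rpow (by linarith) hp.1] at this
    calc K * p ^ β = K / m ^ β * (m ^ β * p ^ β) := by field_simp
      _ ≤ _ := mul_le_mul_of_nonneg_left this (by positivity)
  have hsβ : 0 < q p ^ β := Real.rpow_pos_of_pos h0 _
  rw [rpow_one_add_of_nonneg hp.1 hβ] at h
  set r := min p' (2 * p) with hr
  have hrp : p ≤ r := le_min hpp (by linarith)
  have hr1 : r ≤ p' := min_le_left _ _
  have hrI : r ∈ Icc (0 : ℝ) 1 := ⟨hp.1.trans hrp, hr1.trans hp'.2⟩
  have hr2 : (1 + ε) * p ≤ r + K * p ^ β * p := by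
    have : 0 ≤ K * p ^ β * p := by positivity
    rcases min_cases p' (2 * p) with ⟨e, _⟩ | ⟨e, _⟩ <;> rw [hr, e] <;> nlinarith
  have hdiv : 1 + ε ≤ r / p + K * p ^ β := by
    rw [← mul_le_mul_iff_of_pos_right hp0]
    have : (r / p + K * p ^ β) * p = r + K * p ^ β * p := by field_simp
    linarith
  have hexp2 : K / m ^ β * q p ^ β + 2 * c * q p ^ β ≤ K' * q p ^ β := by
    rw [← add_mul]; exact mul_le_mul_of_nonneg_right hKK hsβ.le
  rcases hrp.eq_or_lt with he | hl
  · apply key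
    rw [← he, div_self hp0.ne'] at hdiv
    have : 0 ≤ 2 * c * q p ^ β := by positivity
    linarith
  · have h1 := hratio p r hp0 hl (by
      rw [min_eq_right hle]; exact min_le_right _ _)
    have h2 : q r ≤ q p' := hmono hrI hp' hr1
    by_cases hbig : (1 + ε) * q p ≤ q p'
    · have : 0 ≤ K' * (q p * q p ^ β) := by positivity
      linarith
    have h3 : q r / q p ≤ q p' / q p := div_le_div_of_nonneg_right h2 h0.le
    have h4 : q p' / q p ≤ 2 := by
      rw [div_le_iff₀ h0]; nlinarith
    have h5 : q p ^ θ ≤ q p ^ β := Real.rpow_le_rpow_of_exponent_ge h0 hs.2 hβθ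
    have h50 : 0 < q p ^ θ := Real.rpow_pos_of_pos h0 _
    have h6 : r / p ≤ q p' / q p + 2 * c * q p ^ β := by
      have a1 : r / p ≤ q p' / q p * (1 + c * q p ^ θ) :=
        h1.trans (mul_le_mul_of_nonneg_right h3 (by positivity))
      have a2 : q p' / q p * (c * q p ^ θ) ≤ 2 * (c * q p ^ β) :=
        mul_le_mul h4 (mul_le_mul_of_nonneg_left h5 hc.le) (by positivity) (by norm_num)
      nlinarith
    have h7 : 1 + ε ≤ q p' / q p + K' * q p ^ β := by linarith
    have h8 := mul_le_mul_of_nonneg_right h7 h0.le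
    have h9 : (q p' / q p + K' * q p ^ β) * q p = q p' + K' * (q p * q p ^ β) := by
      field_simp
    linarith

/-- The layer-cake formula for functions bounded by one. -/
lemma integral_eq_intervalIntegral_meas_lt {μ : Measure ℝ} [IsProbabilityMeasure μ] {f : ℝ → ℝ}
    (hf : Monotone f) (hf01 : ∀ y, f y ∈ Icc (0 : ℝ) 1) :
    ∫ y, f y ∂μ = ∫ t in (0 : ℝ)..1, μ.real {y | t < f y} := by
  have hint : Integrable f μ :=
    Integrable.of_mem_Icc 0 1 hf.measurable.aemeasurable (Eventually.of_forall hf01)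
  rw [hint.integral_eq_integral_meas_lt (Eventually.of_forall fun y => (hf01 y).1),
    intervalIntegral.integral_of_le zero_le_one]
  refine setIntegral_eq_of_subset_of_forall_sdiff_eq_zero measurableSet_Ioi
    Ioc_subset_Ioi_self fun t ht => ?_
  have h1 : 1 < t := by
    by_contra h
    exact ht.2 ⟨ht.1, not_lt.1 h⟩
  have : {y | t < f y} = ∅ :=
    eq_empty_of_forall_notMem fun y hy => absurd ((hf01 y).2) (not_le.2 (h1.trans hy))
  rw [this]; simp

lemma antitone_measureReal_lt {μ : Measure ℝ} [IsProbabilityMeasure μ] (f : ℝ → ℝ) :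
    Antitone fun t => μ.real {y | t < f y} :=
  fun _ _ hst => measureReal_mono fun _ hy => lt_of_le_of_lt hst hy

/-- The balance between gains at levels above `ℓ` and losses below that level. -/
lemma integral_gain_of_levels {Φ φ ψ : ℝ → ℝ} {ℓ r ε β K A B τ : ℝ}
    (hΦ : Antitone Φ) (hφ : Antitone φ)
    (hφ0 : ∀ t, 0 ≤ φ t) (hψΦ : ∀ t, ψ t ≤ Φ t) (hΦ1 : ∀ t, 1 ≤ t → Φ t = 0)
    (hℓ : 0 ≤ ℓ) (hr : 2 * (1 + ε) ≤ r) (hε : 0 < ε) (hε1 : ε ≤ 1 / 2) (hK : 0 ≤ K)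
    (hA : 0 ≤ A) (hB : 0 ≤ B)
    (hscale : ∀ t, 0 < t → ℓ < φ t → φ t ≤ Φ (r * t))
    (hgrow : ∀ t, (1 + ε) * φ t ≤ ψ t + K * φ t ^ (1 + β))
    (hlow : ∀ t, 0 < t → t < τ → 2 * ℓ ≤ ψ t)
    (hhigh : ∀ t, 0 < t → t < 1 → τ ≤ t →
      φ t ≤ ℓ / 2 ∧ φ t ^ (1 + β) ≤ A * φ t + B * t ^ (-(1 / 2) : ℝ)) :
    (1 + ε) * ∫ t in (0 : ℝ)..1, φ t ≤
      (∫ t in (0 : ℝ)..1, Φ t) + K * (A * (∫ t in (0 : ℝ)..1, φ t) + 2 * B) := by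
  have hr0 : 0 < r := by linarith
  have anti_pos : ∀ {f : ℝ → ℝ}, Antitone f → Antitone fun t => max (f t - ℓ) 0 :=
    fun hf s t hst => max_le_max_right 0 (sub_le_sub_right (hf hst) ℓ)
  have iφ : IntervalIntegrable φ volume 0 1 := hφ.intervalIntegrable
  have iΦ : IntervalIntegrable Φ volume 0 1 := hΦ.intervalIntegrable
  have iφp : IntervalIntegrable (fun t => max (φ t - ℓ) 0) volume 0 1 :=
    (anti_pos hφ).intervalIntegrable
  have iΦp : ∀ a b, IntervalIntegrable (fun t => max (Φ t - ℓ) 0) volume a b :=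
    fun a b => (anti_pos hΦ).intervalIntegrable
  have ipow : IntervalIntegrable (fun t : ℝ => t ^ (-(1 / 2) : ℝ)) volume 0 1 :=
    intervalIntegral.intervalIntegrable_rpow' (by norm_num)
  have hpow : ∫ t in (0 : ℝ)..1, t ^ (-(1 / 2) : ℝ) = 2 := by
    rw [integral_rpow (Or.inl (by norm_num))]; norm_num
  have hsc : r * ∫ t in (0 : ℝ)..1, max (φ t - ℓ) 0 ≤
      ∫ t in (0 : ℝ)..1, max (Φ t - ℓ) 0 := by
    have e1 : ∫ t in (0 : ℝ)..1, max (φ t - ℓ) 0 ≤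
        ∫ t in (0 : ℝ)..1, max (Φ (r * t) - ℓ) 0 := by
      refine intervalIntegral.integral_mono_on_of_le_Ioo zero_le_one iφp ?_ ?_
      · have : Antitone fun t => Φ (r * t) :=
          fun s t hst => hΦ (mul_le_mul_of_nonneg_left hst hr0.le)
        exact (anti_pos this).intervalIntegrable
      · intro t ht
        rcases lt_or_ge ℓ (φ t) with h | h
        · exact max_le_max_right 0 (sub_le_sub_right (hscale t ht.1 h) ℓ)
        · rw [max_eq_right (by linarith)]; exact le_max_right _ _
    have e2 := intervalIntegral.integral_comp_mul_left (a := 0) (b := 1)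
      (fun t => max (Φ t - ℓ) 0) hr0.ne'
    rw [mul_zero, mul_one, smul_eq_mul] at e2
    have e3 : ∫ t in (1 : ℝ)..r, max (Φ t - ℓ) 0 = 0 := by
      rw [intervalIntegral.integral_congr (g := fun _ => (0 : ℝ))]
      · simp
      · intro t ht
        rw [uIcc_of_le (by linarith)] at ht
        simp [hΦ1 t ht.1, hℓ]
    have e4 := intervalIntegral.integral_add_adjacent_intervals (iΦp 0 1) (iΦp 1 r)
    rw [e3, add_zero] at e4
    rw [e2, ← e4] at e1
    calc _ ≤ r * (r⁻¹ * ∫ t in (0 : ℝ)..1, max (Φ t - ℓ) 0) :=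
          mul_le_mul_of_nonneg_left e1 hr0.le
      _ = _ := by field_simp
  have hpt : ∀ t ∈ Ioo (0 : ℝ) 1, (1 + ε) * φ t ≤
      (Φ t - 1 / 2 * max (Φ t - ℓ) 0) + (1 + ε) * max (φ t - ℓ) 0 +
        (K * A * φ t + K * B * t ^ (-(1 / 2) : ℝ)) := by
    intro t ht
    have ht0 : 0 < t ^ (-(1 / 2) : ℝ) := Real.rpow_pos_of_pos ht.1 _
    have n1 : 0 ≤ K * A * φ t := mul_nonneg (mul_nonneg hK hA) (hφ0 t)
    have n2 : 0 ≤ K * B * t ^ (-(1 / 2) : ℝ) := by positivity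
    have n3 : φ t - ℓ ≤ max (φ t - ℓ) 0 := le_max_left _ _
    have n4 : 0 ≤ max (φ t - ℓ) 0 := le_max_right _ _
    rcases lt_or_ge t τ with h | h
    · have h1 := hlow t ht.1 h
      have h2 := hψΦ t
      rw [max_eq_left (a := Φ t - ℓ) (by linarith)]
      nlinarith
    · obtain ⟨h1, h2⟩ := hhigh t ht.1 ht.2 h
      have h3 := hgrow t
      have h4 := mul_le_mul_of_nonneg_left h2 hK
      have h5 := hψΦ t
      have h6 := hφ0 t
      rcases max_cases (Φ t - ℓ) 0 with ⟨e, _⟩ | ⟨e, _⟩ <;> rw [e] <;> nlinarith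
  have iR1 : IntervalIntegrable (fun t => Φ t - 1 / 2 * max (Φ t - ℓ) 0) volume 0 1 :=
    iΦ.sub ((iΦp 0 1).const_mul _)
  have iR2 := iR1.add (iφp.const_mul (1 + ε))
  have iR3 := (iφ.const_mul (K * A)).add (ipow.const_mul (K * B))
  have main := intervalIntegral.integral_mono_on_of_le_Ioo zero_le_one
    (iφ.const_mul (1 + ε)) (iR2.add iR3) hpt
  rw [intervalIntegral.integral_const_mul, intervalIntegral.integral_add iR2 iR3,
    intervalIntegral.integral_add iR1 (iφp.const_mul (1 + ε)),
    intervalIntegral.integral_sub iΦ ((iΦp 0 1).const_mul _),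
    intervalIntegral.integral_add (iφ.const_mul (K * A)) (ipow.const_mul (K * B)),
    intervalIntegral.integral_const_mul, intervalIntegral.integral_const_mul,
    intervalIntegral.integral_const_mul, intervalIntegral.integral_const_mul, hpow] at main
  have hp0 : 0 ≤ ∫ t in (0 : ℝ)..1, max (φ t - ℓ) 0 :=
    intervalIntegral.integral_nonneg zero_le_one fun t _ => le_max_right _ _
  have := mul_le_mul_of_nonneg_right hr hp0
  linarith

/-- Convolution with an exponentially decaying kernel worsens the constant in a growth bound
by at most the factor `γ`. -/
lemma growthBound_convD {G : ℝ → ℝ → ℝ} {v : ℝ → ℝ} {a M₀ M ε₀ ε β K γ R ρ : ℝ}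
    (hGD : ∀ y, MemD (G y))
    (hG1 : ∀ x, Monotone (fun y => G y (x - y))) (hG1' : ∀ x, Antitone (fun y => G y x))
    (hG2 : ∀ y x M : ℝ, 0 ≤ x → M₀ ≤ M → G (y - M) (x + M) ≤ Real.exp (-(a * M)) * G y x)
    (hG3 : ∀ y, 1 - ε₀ ≤ G y 0) (hv : MemD v) (hvg : GrowthBound ε M β K v)
    (hε : 0 < ε) (hε1 : ε ≤ 1 / 2) (hβ : 0 < β) (hβ1 : β ≤ 1) (hεK : ε ≤ K)
    (hM : 0 < M) (hM₀ : M₀ ≤ M) (hε₀ : ε₀ < 1) (hρ : 1 + ε ≤ ρ * (1 - ε₀))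
    (hR : 16 ≤ R) (hRM : Real.exp (a * M) = R ^ 2)
    (hγ : ρ ^ β + 2 * (16 / R * ρ ^ (1 + β)) ≤ γ) :
    GrowthBound ε M β (K * γ) (convD G v) := by
  intro x
  have := hv.isProbabilityMeasure
  set μ := lsMeasure v with hμ
  have hK : 0 ≤ K := hε.le.trans hεK
  have hG01 : ∀ y z, G y z ∈ Icc (0 : ℝ) 1 := fun y z => (hGD y).2.2.1 z
  have hvn : ∀ y, 0 ≤ v y := fun y => (hv.2.2.1 y).1
  have hconv : ∀ z, convD G v z = ∫ t in (0 : ℝ)..1, μ.real {y | t < G y (z - y)} :=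
    fun z => integral_eq_intervalIntegral_meas_lt (hG1 z) fun y => hG01 _ _
  set W := convD G v x with hW
  have hW0 : 0 ≤ W := by rw [hW]; exact integral_nonneg fun y => (hG01 _ _).1
  have hρ0 : 0 < ρ := by
    by_contra h
    nlinarith [not_lt.1 h]
  have hγ0 : 0 ≤ γ := by
    refine le_trans ?_ hγ
    have := Real.rpow_nonneg hρ0.le β
    have := Real.rpow_nonneg hρ0.le (1 + β)
    have : 0 < R := by linarith
    positivity
  by_cases hbig : (1 + ε) * W ≤ convD G v (x - M)
  · have := Real.rpow_nonneg hW0 (1 + β)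
    have : 0 ≤ K * γ * W ^ (1 + β) := by positivity
    linarith
  have hsmall : v (x - M) ≤ ρ * W := by
    have h1 : (1 - ε₀) * v (x - M) ≤ convD G v (x - M) := by
      have e : ∫ y, (Ioi (x - M)).indicator (fun _ => 1 - ε₀) y ∂μ = (1 - ε₀) * v (x - M) := by
        rw [integral_indicator_const _ measurableSet_Ioi, hv.measureReal_Ioi, smul_eq_mul,
          mul_comm]
      rw [← e]
      refine integral_mono ((integrable_const _).indicator measurableSet_Ioi)
        (Integrable.of_mem_Icc 0 1 (hG1 (x - M)).measurable.aemeasurable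
          (Eventually.of_forall fun y => hG01 _ _)) fun y => ?_
      by_cases hy : y ∈ Ioi (x - M)
      · rw [indicator_of_mem hy]
        exact (hG3 y).trans ((hGD y).1 (by simp only [mem_Ioi] at hy; linarith))
      · rw [indicator_of_notMem hy]; exact (hG01 _ _).1
    have h2 : (1 - ε₀) * v (x - M) ≤ ρ * (1 - ε₀) * W :=
      h1.trans ((not_le.1 hbig).le.trans (mul_le_mul_of_nonneg_right hρ hW0))
    have h3 : 0 < 1 - ε₀ := by linarith
    refine le_of_mul_le_mul_left ?_ h3
    linarith
  have hmain : (1 + ε) * W ≤ convD G v (x - M) +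
      K * (v (x - M) ^ β * W + 2 * (16 / R * v (x - M) ^ (1 + β))) := by
    have hR0 : 0 < R := by linarith
    set r := Real.exp (a * M) with hr
    have hexp : ∀ i : ℕ, Real.exp (-(a * (i * M))) = (R ^ i)⁻¹ ^ 2 := by
      intro i
      rw [show -(a * (i * M)) = -((i : ℝ) * (a * M)) by ring, Real.exp_neg, Real.exp_nat_mul,
        ← hr, hRM, inv_pow, ← pow_mul, ← pow_mul, mul_comm]
    set φ : ℝ → ℝ := fun t => μ.real {y | t < G y (x - y)} with hφ
    set h : ℕ → ℝ := fun i => G (x - i * M) (i * M) with hh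
    set V : ℕ → ℝ := fun i => v (x - i * M) with hV
    have hV1 : v (x - M) = V 1 := by simp [hV]
    rw [hV1]
    have hVmono : Monotone V := by
      intro i j hij
      have : (i : ℝ) * M ≤ j * M := mul_le_mul_of_nonneg_right (by exact_mod_cast hij) hM.le
      exact hv.1 (by linarith)
    have hVμ : ∀ i : ℕ, V i = μ.real (Ioi (x - i * M)) := fun i => (hv.measureReal_Ioi _).symm
    have hdecay : ∀ i : ℕ, 1 ≤ i → h i ≤ (R ^ i)⁻¹ ^ 2 := by
      intro i hi
      have hi' : (1 : ℝ) ≤ i := by exact_mod_cast hi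
      have := hG2 x 0 (i * M) le_rfl (by nlinarith)
      rw [zero_add, hexp] at this
      exact this.trans (mul_le_of_le_one_right (by positivity) (hG01 _ _).2)
    have hφV : ∀ t i, h i ≤ t → φ t ≤ V i := by
      intro t i hit
      rw [hVμ]
      refine measureReal_mono fun y (hy : t < G y (x - y)) => ?_
      by_contra hy'
      have h1 := hG1 x (not_lt.1 hy')
      simp only [sub_sub_cancel] at h1
      exact absurd (hit.trans_lt hy) (not_lt.2 h1)
    have hφ0 : ∀ t, 0 ≤ φ t := fun t => measureReal_nonneg
    have hVn : ∀ i, 0 ≤ V i := fun i => hvn _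
    have hpow : ∀ t, 0 < t → ∀ k : ℕ, (∀ i ≤ k, V (i + 1) ≤ 4 ^ i * V 1) → h (k + 1) ≤ t →
        φ t ^ (1 + β) ≤ V 1 ^ β * φ t + 16 / R * V 1 ^ (1 + β) * t ^ (-(1 / 2) : ℝ) := by
      intro t ht k hk hkt
      have hex : ∃ j, h (j + 1) ≤ t := ⟨k, hkt⟩
      classical
      obtain ⟨j, hj, hjk, hjmin⟩ : ∃ j, h (j + 1) ≤ t ∧ j ≤ k ∧ ∀ i < j, t < h (i + 1) :=
        ⟨Nat.find hex, Nat.find_spec hex, Nat.find_min' hex hkt,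
          fun i hi => not_le.1 (Nat.find_min hex hi)⟩
      have hn1 := Real.rpow_nonneg (hVn 1) (1 + β)
      have hn2 : 0 < t ^ (-(1 / 2) : ℝ) := Real.rpow_pos_of_pos ht _
      have hn3 := Real.rpow_nonneg (hVn 1) β
      rcases j with _ | j
      · have h1 := hφV t 1 hj
        rw [rpow_one_add_of_nonneg (hφ0 t) hβ, mul_comm]
        have h2 := mul_le_mul_of_nonneg_right (Real.rpow_le_rpow (hφ0 t) h1 hβ.le) (hφ0 t)
        have h3 : 0 ≤ 16 / R * V 1 ^ (1 + β) * t ^ (-(1 / 2) : ℝ) := by positivity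
        linarith
      · have h1 : φ t ≤ 4 ^ (j + 1) * V 1 := (hφV t _ hj).trans (hk _ hjk)
        have h2 : t ≤ (R ^ (j + 1))⁻¹ ^ 2 :=
          (hjmin j (Nat.lt_succ_self j)).le.trans (hdecay _ (by omega))
        have h3 : R ^ (j + 1) ≤ t ^ (-(1 / 2) : ℝ) := by
          have e : ((R ^ (j + 1))⁻¹ ^ 2) ^ (-(1 / 2) : ℝ) = R ^ (j + 1) := by
            rw [← Real.rpow_natCast _ 2, ← Real.rpow_mul (by positivity)]
            norm_num
            rw [Real.rpow_neg_one, inv_inv]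
          rw [← e]
          exact Real.rpow_le_rpow_of_nonpos ht h2 (by norm_num)
        have h4 : (16 : ℝ) ^ (j + 1) ≤ 16 / R * R ^ (j + 1) := by
          have e : 16 / R * R ^ (j + 1) = 16 * R ^ j := by
            rw [pow_succ]; field_simp
          rw [e, pow_succ, mul_comm]
          exact mul_le_mul_of_nonneg_left (pow_le_pow_left₀ (by norm_num) hR j) (by norm_num)
        have h5 : ((4 : ℝ) ^ (j + 1)) ^ (1 + β) ≤ 16 ^ (j + 1) := by
          have e : (16 : ℝ) ^ (j + 1) = ((4 : ℝ) ^ (j + 1)) ^ (2 : ℝ) := by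
            rw [← Real.rpow_natCast _ (j + 1), ← Real.rpow_natCast _ (j + 1),
              ← Real.rpow_mul (by norm_num), mul_comm, Real.rpow_mul (by norm_num)]
            norm_num
          rw [e]
          exact Real.rpow_le_rpow_of_exponent_le (one_le_pow₀ (by norm_num)) (by linarith)
        have h6 : (4 ^ (j + 1) * V 1) ^ (1 + β) ≤ 16 ^ (j + 1) * V 1 ^ (1 + β) := by
          rw [Real.mul_rpow (by positivity) (hVn 1)]
          exact mul_le_mul_of_nonneg_right h5 hn1
        have h7 : φ t ^ (1 + β) ≤ (4 ^ (j + 1) * V 1) ^ (1 + β) :=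
          Real.rpow_le_rpow (hφ0 t) h1 (by linarith)
        have h8 : (16 : ℝ) ^ (j + 1) ≤ 16 / R * t ^ (-(1 / 2) : ℝ) :=
          h4.trans (mul_le_mul_of_nonneg_left h3 (by positivity))
        have h9 := mul_le_mul_of_nonneg_right h8 hn1
        have h10 : 0 ≤ V 1 ^ β * φ t := mul_nonneg hn3 (hφ0 t)
        linarith
    have hiter : ∀ k : ℕ, (∀ i < k, V (i + 2) ≤ 4 * V (i + 1)) →
        ∀ i ≤ k, V (i + 1) ≤ 4 ^ i * V 1 := by
      intro k hk i
      induction i with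
      | zero => simp
      | succ i ih =>
        intro hi
        have h1 := ih (by omega)
        have h2 := hk i (by omega)
        rw [pow_succ]
        linarith
    obtain ⟨ℓ, τ, hℓV, hlow, hhigh⟩ : ∃ ℓ τ : ℝ, V 1 ≤ ℓ ∧
        (∀ t, 0 < t → t < τ → 2 * ℓ ≤ μ.real {y | t < G (y + M) (x - (y + M))}) ∧
        (∀ t, 0 < t → t < 1 → τ ≤ t → φ t ≤ ℓ / 2 ∧
          φ t ^ (1 + β) ≤ V 1 ^ β * φ t + 16 / R * V 1 ^ (1 + β) * t ^ (-(1 / 2) : ℝ)) := by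
      by_cases hex : ∃ k : ℕ, 4 * V (k + 1) < V (k + 2)
      · classical
        obtain ⟨k, hk, hkmin⟩ : ∃ k : ℕ, 4 * V (k + 1) < V (k + 2) ∧
            ∀ i < k, V (i + 2) ≤ 4 * V (i + 1) :=
          ⟨Nat.find hex, Nat.find_spec hex, fun i hi => not_lt.1 (Nat.find_min hex hi)⟩
        refine ⟨2 * V (k + 1), h (k + 1), ?_, ?_, ?_⟩
        · have := hVmono (show 1 ≤ k + 1 by omega)
          linarith [hVn (k + 1)]
        · intro t _ htk
          have e : V (k + 2) ≤ μ.real {y | t < G (y + M) (x - (y + M))} := by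
            rw [hVμ]
            refine measureReal_mono fun y hy => htk.trans_le ?_
            have h1 : x - ((k + 1 : ℕ) : ℝ) * M ≤ y + M := by
              simp only [mem_Ioi] at hy
              push_cast at hy ⊢
              linarith
            have h2 := hG1 x h1
            simpa only [sub_sub_cancel] using h2
          linarith
        · intro t ht _ hkt
          exact ⟨by linarith [hφV t _ hkt], hpow t ht k (hiter k hkmin) hkt⟩
      · push Not at hex
        refine ⟨2, 0, ?_, fun t h0 h1 => absurd h0 h1.not_gt, fun t ht _ _ => ⟨?_, ?_⟩⟩
        · have := (hv.2.2.1 (x - (1 : ℕ) * M)).2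
          simp only [hV]; linarith
        · have : φ t ≤ 1 := measureReal_le_one
          linarith
        · obtain ⟨k, hk⟩ := exists_pow_lt_of_lt_one ht
            (show (R⁻¹) ^ 2 < 1 by
              rw [inv_pow]; exact inv_lt_one_of_one_lt₀ (by nlinarith))
          refine hpow t ht k (hiter k fun i _ => hex i) ?_
          refine (hdecay (k + 1) (by omega)).trans (le_trans ?_ hk.le)
          rw [← inv_pow, ← pow_mul, mul_comm, pow_mul]
          refine pow_le_pow_of_le_one (by positivity) ?_ (Nat.le_succ k)
          rw [inv_pow]; exact inv_le_one_of_one_le₀ (by nlinarith)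
    have hHM : ∀ y, G (y + M) (x - (y + M)) ≤ G y (x - M - y) := by
      intro y
      have := hG1' (x - (y + M)) (show y ≤ y + M by linarith)
      simp only at this
      rwa [show x - M - y = x - (y + M) by ring]
    have key := integral_gain_of_levels (Φ := fun t => μ.real {y | t < G y (x - M - y)})
      (φ := φ) (ψ := fun t => μ.real {y | t < G (y + M) (x - (y + M))}) (ℓ := ℓ) (r := r)
      (ε := ε) (β := β) (K := K) (A := V 1 ^ β) (B := 16 / R * V 1 ^ (1 + β)) (τ := τ)
      (antitone_measureReal_lt _) (antitone_measureReal_lt _) hφ0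
      (fun t => measureReal_mono fun y hy => lt_of_lt_of_le hy (hHM y))
      (fun t ht => by
        have : {y | t < G y (x - M - y)} = ∅ :=
          eq_empty_of_forall_notMem fun y hy => absurd (hG01 y (x - M - y)).2
            (not_le.2 (ht.trans_lt hy))
        simp [this])
      ((hVn 1).trans hℓV) (by rw [hRM]; nlinarith) hε hε1 hK (Real.rpow_nonneg (hVn 1) _)
      (mul_nonneg (by positivity) (Real.rpow_nonneg (hVn 1) _))
      (fun t ht hlt => by
        obtain ⟨y, hy, hyx⟩ : ∃ y, t < G y (x - y) ∧ y ≤ x - M := by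
          by_contra hcon
          push Not at hcon
          refine absurd (hℓV.trans_lt hlt) (not_lt.2 ?_)
          rw [← hV1, ← hv.measureReal_Ioi]
          exact measureReal_mono fun y hy => hcon y hy
        have hscale : ∀ z, t < G z (x - z) → z ≤ x - M → r * t < G z (x - M - z) := by
          intro z hz hzx
          have h1 := hG2 z (x - M - z) M (by linarith) hM₀
          rw [show x - M - z + M = x - z by ring, Real.exp_neg, ← hr] at h1
          have h2 := hG1' (x - z) (show z - M ≤ z by linarith)
          have hr0 : 0 < r := Real.exp_pos _
          have h3 : r * G (z - M) (x - z) ≤ G z (x - M - z) := by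
            have := mul_le_mul_of_nonneg_left h1 hr0.le
            rwa [← mul_assoc, mul_inv_cancel₀ hr0.ne', one_mul] at this
          exact (mul_lt_mul_of_pos_left (hz.trans_le h2) hr0).trans_le h3
        refine measureReal_mono fun z hz => ?_
        rcases le_total z (x - M) with hzx | hzx
        · exact hscale z hz hzx
        · exact (hscale y hy hyx).trans_le (hG1 (x - M) (hyx.trans hzx)))
      (fun t => hvg.upperSet hv hβ hεK fun y z hyz hy => lt_of_lt_of_le hy (hG1 x hyz))
      hlow hhigh
    rwa [← hconv, ← hconv, ← hW] at key
  have hv1 := hvn (x - M)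
  have e1 : v (x - M) ^ β ≤ ρ ^ β * W ^ β := by
    rw [← Real.mul_rpow hρ0.le hW0]; exact Real.rpow_le_rpow hv1 hsmall hβ.le
  have e2 : v (x - M) ^ (1 + β) ≤ ρ ^ (1 + β) * W ^ (1 + β) := by
    rw [← Real.mul_rpow hρ0.le hW0]; exact Real.rpow_le_rpow hv1 hsmall (by linarith)
  have e3 := mul_le_mul_of_nonneg_right e1 hW0
  have e4 : ρ ^ β * W ^ β * W = ρ ^ β * W ^ (1 + β) := by
    rw [rpow_one_add_of_nonneg hW0 hβ]; ring
  have e5 : (16 / R) * v (x - M) ^ (1 + β) ≤ 16 / R * (ρ ^ (1 + β) * W ^ (1 + β)) :=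
    mul_le_mul_of_nonneg_left e2 (by have : 0 < R := by linarith
                                     positivity)
  have e6 := mul_le_mul_of_nonneg_right hγ (Real.rpow_nonneg hW0 (1 + β))
  have e7 : v (x - M) ^ β * W + 2 * (16 / R * v (x - M) ^ (1 + β)) ≤ γ * W ^ (1 + β) := by
    linarith
  have e8 := mul_le_mul_of_nonneg_left e7 hK
  linarith

/-- Uniformly in `n`, the functions `u n` fall from level `lam` to any positive level within a
bounded distance. -/
def Descends (u : ℕ → ℝ → ℝ) (lam : ℝ) : Prop :=
  ∀ η : ℝ, 0 < η → ∃ A : ℝ, 0 ≤ A ∧ ∀ n z, u n z ≤ lam → u n (z + A) < η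

lemma exists_descends_of_growthBound {u : ℕ → ℝ → ℝ} {ε M β K : ℝ} (hu : ∀ n, MemD (u n))
    (h : ∀ n, GrowthBound ε M β K (u n)) (hε : 0 < ε) (hM : 0 ≤ M) (hβ : 0 < β) (hK : 0 < K) :
    ∃ δ, 0 < δ ∧ Descends u δ := by
  set δ := (ε / (2 * K)) ^ β⁻¹ with hδ
  have hδ0 : 0 < δ := by positivity
  have hδβ : K * δ ^ β ≤ ε / 2 := by
    rw [hδ, Real.rpow_inv_rpow (by positivity) hβ.ne']
    exact le_of_eq (by field_simp)
  have hstep : ∀ n y, u n y ≤ δ → (1 + ε / 2) * u n (y + M) ≤ u n y := by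
    intro n y hy
    have h0 := ((hu n).2.2.1 (y + M)).1
    have h1 : u n (y + M) ≤ δ := ((hu n).1 (by linarith)).trans hy
    have h2 := h n (y + M)
    rw [rpow_one_add_of_nonneg h0 hβ, add_sub_cancel_right] at h2
    have h3 : K * u n (y + M) ^ β ≤ ε / 2 :=
      (mul_le_mul_of_nonneg_left (Real.rpow_le_rpow h0 h1 hβ.le) hK.le).trans hδβ
    nlinarith
  refine ⟨δ, hδ0, fun η hη => ?_⟩
  obtain ⟨j, hj⟩ := pow_unbounded_of_one_lt η⁻¹ (show 1 < 1 + ε / 2 by linarith)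
  refine ⟨j * M, by positivity, fun n z hz => ?_⟩
  have hiter : ∀ i : ℕ, (1 + ε / 2) ^ i * u n (z + i * M) ≤ u n z := by
    intro i
    induction i with
    | zero => simp
    | succ i ih =>
      have hi : u n (z + i * M) ≤ δ :=
        ((hu n).1 (le_add_of_nonneg_right (by positivity))).trans hz
      have h1 := hstep n _ hi
      have h2 := mul_le_mul_of_nonneg_left h1 (show 0 ≤ (1 + ε / 2) ^ i by positivity)
      push_cast
      rw [pow_succ, show z + ((i : ℝ) + 1) * M = z + i * M + M by ring]
      linarith
  have h1 := (hiter j).trans ((hu n).2.2.1 z).2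
  by_contra hcon
  have h2 : η⁻¹ * η < (1 + ε / 2) ^ j * η := mul_lt_mul_of_pos_right hj hη
  rw [inv_mul_cancel₀ hη.ne'] at h2
  have h3 := mul_le_mul_of_nonneg_left (not_lt.1 hcon)
    (show 0 ≤ (1 + ε / 2) ^ j by positivity)
  linarith

/-- The comparison with `q` transfers descent from level `lam` to every level below `q lam`. -/
lemma Descends.step {u : ℕ → ℝ → ℝ} {q : ℝ → ℝ} {lam lam' : ℝ} (hd : Descends u lam)
    (hu : ∀ n, MemD (u n)) (hmono : StrictMonoOn q (Icc 0 1)) (hcont : ContinuousOn q (Icc 0 1))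
    (hq0 : q 0 = 0) (hlam0 : 0 < lam) (hlam1 : lam < 1) (hlam' : lam' < q lam)
    (hlam'1 : lam' < 1) (hu0 : ∀ x, u 0 x = if x < 0 then 1 else 0)
    (hT : ∀ η₁ : ℝ, 0 < η₁ → ∃ B : ℝ, 0 ≤ B ∧ ∀ n x,
      q (u n (x + B)) - η₁ ≤ u (n + 1) x ∧ u (n + 1) x ≤ q (u n (x - B)) + η₁) :
    Descends u lam' := by
  intro η hη
  obtain ⟨η', hη'0, hη'1, hη'⟩ : ∃ η', 0 < η' ∧ η' ≤ 1 ∧ q η' < η / 2 := by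
    have h0 : (0 : ℝ) ∈ Icc (0 : ℝ) 1 := ⟨le_rfl, zero_le_one⟩
    obtain ⟨ν, hν, hc⟩ := Metric.continuousWithinAt_iff.1 (hcont 0 h0) (η / 2) (by linarith)
    have hm : 0 < min (ν / 2) 1 := by positivity
    refine ⟨min (ν / 2) 1, hm, min_le_right _ _, ?_⟩
    have h1 := hc (x := min (ν / 2) 1) ⟨hm.le, min_le_right _ _⟩ (by
      rw [Real.dist_eq, sub_zero, abs_of_pos hm]
      exact (min_le_left _ _).trans_lt (by linarith))
    rw [hq0, Real.dist_eq, sub_zero] at h1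
    exact (abs_lt.1 h1).2
  obtain ⟨B, hB, hTB⟩ := hT (min (η / 2) ((q lam - lam') / 2))
    (lt_min (by linarith) (by linarith))
  obtain ⟨A, hA, hAd⟩ := hd η' hη'0
  refine ⟨A + 2 * B, by linarith, fun n z hz => ?_⟩
  rcases n with _ | n
  · have hz0 : ¬ z < 0 := fun h => by
      rw [hu0, if_pos h] at hz; linarith
    rw [hu0, if_neg (by linarith)]
    exact hη
  · have h1 := (hTB n z).1
    have h2 := min_le_right (η / 2) ((q lam - lam') / 2)
    have h3 : u n (z + B) < lam :=
      (hmono.lt_iff_lt ((hu n).2.2.1 _) ⟨hlam0.le, hlam1.le⟩).1 (by linarith)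
    have h4 := hAd n _ h3.le
    have h5 := (hTB n (z + (A + 2 * B))).2
    rw [show z + (A + 2 * B) - B = z + B + A by ring] at h5
    have h6 := hmono.monotoneOn ((hu n).2.2.1 (z + B + A)) ⟨hη'0.le, hη'1⟩ h4.le
    have h7 := min_le_left (η / 2) ((q lam - lam') / 2)
    linarith

/-- If descent transfers from `lam` to all levels below `q lam`, where `q` has no fixed point
in `(0, 1)`, then it holds from every level below one. -/
lemma Descends.of_step {u : ℕ → ℝ → ℝ} {q : ℝ → ℝ} {δ : ℝ} (hd : Descends u δ) (hδ0 : 0 < δ)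
    (hcont : ContinuousOn q (Icc 0 1)) (hfix : ∀ x : ℝ, 0 < x → x < 1 → x < q x)
    (hstep : ∀ lam lam' : ℝ, 0 < lam → lam < 1 → lam' < q lam → Descends u lam →
      Descends u lam') {κ : ℝ} (hκ : κ < 1) : Descends u κ := by
  by_contra hcon
  have hlt : ∀ lam, Descends u lam → lam < κ := fun lam hlam => by
    by_contra h
    refine hcon fun η hη => ?_
    obtain ⟨A, hA, hAd⟩ := hlam η hη
    exact ⟨A, hA, fun n z hz => hAd n z (hz.trans (not_lt.1 h))⟩
  set S := {lam | Descends u lam} with hS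
  have hbdd : BddAbove S := ⟨κ, fun lam hlam => (hlt lam hlam).le⟩
  have hne : S.Nonempty := ⟨δ, hd⟩
  set s := sSup S with hs
  have hsδ : δ ≤ s := le_csSup hbdd hd
  have hs1 : s < 1 := (csSup_le hne fun lam hlam => (hlt lam hlam).le).trans_lt hκ
  have hqs := hfix s (by linarith) hs1
  obtain ⟨ν, hν, hc⟩ := Metric.continuousWithinAt_iff.1
    (hcont s ⟨by linarith, hs1.le⟩) ((q s - s) / 2) (by linarith)
  obtain ⟨lam, hlam, hlams⟩ := exists_lt_of_lt_csSup hne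
    (show max (s - ν) (s - δ / 2) < s from max_lt (by linarith) (by linarith))
  have hle : lam ≤ s := le_csSup hbdd hlam
  have h1 := (le_max_left (s - ν) (s - δ / 2)).trans_lt hlams
  have h2 := (le_max_right (s - ν) (s - δ / 2)).trans_lt hlams
  have h3 := hc (x := lam) ⟨by linarith, by linarith⟩ (by
    rw [Real.dist_eq, abs_lt]; constructor <;> linarith)
  rw [Real.dist_eq, abs_lt] at h3
  have h4 := hstep lam ((s + q s) / 2) (by linarith) (by linarith) (by linarith) hlam
  have h5 : (s + q s) / 2 ≤ s := le_csSup hbdd h4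
  linarith

lemma tightAfterCentering_of_descends {u : ℕ → ℝ → ℝ} (hu : ∀ n, MemD (u n))
    (hd : ∀ κ : ℝ, κ < 1 → Descends u κ) : TightAfterCentering (fun n x => 1 - u n x) := by
  intro ε hε
  set e := min ε (1 / 2) with he
  have he0 : 0 < e := lt_min hε (by norm_num)
  have he1 : e ≤ ε := min_le_left _ _
  have he2 : e ≤ 1 / 2 := min_le_right _ _
  obtain ⟨A, hA, hAd⟩ := hd (1 - e / 2) (by linarith) (e / 2) (by linarith)
  refine ⟨A + 2, by linarith, fun n => ?_⟩
  simp only [Med]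
  set S := {x | 1 / 2 ≤ 1 - u n x} with hS
  set x₀ := sInf S with hx₀
  have hne : S.Nonempty := by
    obtain ⟨x, hx⟩ := ((hu n).2.2.2.2.eventually_lt_const
      (show (0 : ℝ) < 1 / 2 by norm_num)).exists
    exact ⟨x, by simp only [hS, mem_ofPred_eq]; linarith⟩
  have hbdd : BddBelow S := by
    obtain ⟨x, hx⟩ := ((hu n).2.2.2.1.eventually_const_lt
      (show (1 / 2 : ℝ) < 1 by norm_num)).exists
    refine ⟨x, fun y hy => ?_⟩
    by_contra h
    have h1 := (hu n).1 (not_le.1 h).le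
    simp only [hS, mem_ofPred_eq] at hy
    linarith
  have hright : u n (x₀ + 1) ≤ 1 / 2 := by
    obtain ⟨y, hy, hyx⟩ := exists_lt_of_csInf_lt hne (show sInf S < x₀ + 1 by linarith)
    have h1 := (hu n).1 hyx.le
    simp only [hS, mem_ofPred_eq] at hy
    linarith
  have hleft : 1 / 2 < u n (x₀ - 2) := by
    by_contra h
    have : x₀ ≤ x₀ - 2 := csInf_le hbdd (by simp only [hS, mem_ofPred_eq]; linarith)
    linarith
  have h1 : 1 - e / 2 < u n (-(A + 2) + x₀) := by
    by_contra h
    have h2 := hAd n _ (not_lt.1 h)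
    rw [show -(A + 2) + x₀ + A = x₀ - 2 by ring] at h2
    linarith
  have h2 := hAd n (x₀ + 1) (by linarith)
  have h3 := (hu n).1 (show x₀ + 1 + A ≤ A + 2 + x₀ by linarith)
  linarith

/-- Theorem 2.5: under Assumptions 2.1, 2.2 and 2.4, and with `F₀(x) = 1_{x ≥ 0}`,
the solutions of the recursion `F̄ₙ₊₁ = Tₙ F̄ₙ = Ḡₙ ⊛ Qₙ(F̄ₙ)` are tight after
centering. -/
theorem tightness_of_recursion
    (Q : ℕ → ℝ → ℝ) (G : ℕ → ℝ → ℝ → ℝ) (δ₀ m cs θs a M₀ : ℝ)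
    (hQ : Assumption21 Q δ₀ m cs θs)
    (hG : Assumption22 G a M₀ (Real.log m / 100))
    (hT : ∃ Qt : ℝ → ℝ, MemQt Qt ∧ ∀ η₁ : ℝ, 0 < η₁ → ∃ B : ℝ, 0 ≤ B ∧
      ∀ (n : ℕ) (u v : ℝ → ℝ), MemD u → MemD v → (∀ y, v y = Q n (u y)) →
        ∀ x : ℝ, Qt (u (x + B)) - η₁ ≤ convD (G n) v x ∧
          convD (G n) v x ≤ Qt (u (x - B)) + η₁)
    (Fbar : ℕ → ℝ → ℝ)
    (hF0 : ∀ x : ℝ, Fbar 0 x = if x < 0 then 1 else 0)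
    (hFD : ∀ n, MemD (Fbar n))
    (hrec : ∀ n, MemD (fun y => Q n (Fbar n y)) ∧
      ∀ x : ℝ, Fbar (n + 1) x = convD (G n) (fun y => Q n (Fbar n y)) x) :
    TightAfterCentering (fun n x => 1 - Fbar n x) := by
  obtain ⟨hδ₀, hm, hm2, hcs, hθs, hmono, hmaps, hQ0, -, hexp, hratio⟩ := hQ
  obtain ⟨ha, -, -, hGD, hG1, hG1', hG2, hG3⟩ := hG
  obtain ⟨Qt, hQt, hT⟩ := hT
  set L := Real.log m with hL
  have hL0 : 0 < L := Real.log_pos hm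
  have hL1 : L ≤ 1 := by
    have := Real.log_le_sub_one_of_pos (show 0 < m by linarith)
    linarith
  set β := min θs 1 with hβdef
  have hβ : 0 < β := lt_min hθs one_pos
  set γ := m ^ (β / 2) with hγdef
  have hm0 : 0 < m := by linarith
  have hγ1 : 1 < γ := Real.one_lt_rpow hm (by linarith)
  have hγ2 : m ^ β = γ ^ 2 := by
    rw [hγdef, ← Real.rpow_natCast, ← Real.rpow_mul hm0.le]; norm_num
  set ρ := m ^ (1 / 4 : ℝ) with hρdef
  have hρ : 1 + L / 100 ≤ ρ * (1 - L / 100) := by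
    have h1 : 1 + L / 4 ≤ ρ := by
      rw [hρdef, Real.rpow_def_of_pos hm0, ← hL]
      linarith [Real.add_one_le_exp (L * (1 / 4))]
    nlinarith
  have hρ0 : 0 < ρ := Real.rpow_pos_of_pos hm0 _
  have hργ : ρ ^ β < γ := by
    rw [hρdef, ← Real.rpow_mul hm0.le]
    exact Real.rpow_lt_rpow_of_exponent_lt hm (by linarith)
  have hρ2 : 0 < ρ ^ (1 + β) := Real.rpow_pos_of_pos hρ0 _
  have hd : 0 < γ - ρ ^ β := by linarith
  set R := 16 + 32 * ρ ^ (1 + β) / (γ - ρ ^ β) + Real.exp (a * M₀ / 2) with hRdef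
  have hterm : 0 < 32 * ρ ^ (1 + β) / (γ - ρ ^ β) := by positivity
  have hexp0 := Real.exp_pos (a * M₀ / 2)
  have hR16 : 16 ≤ R := by linarith
  have hR0 : 0 < R := by linarith
  have hlogR : 0 < Real.log R := Real.log_pos (by linarith)
  set M := 2 * Real.log R / a with hMdef
  have hM : 0 < M := by positivity
  have haM : a * M = 2 * Real.log R := by rw [hMdef]; field_simp
  have hM₀ : M₀ ≤ M := by
    have h1 : a * M₀ / 2 ≤ Real.log R := (Real.le_log_iff_exp_le hR0).2 (by linarith)
    rw [hMdef, le_div_iff₀ ha]; linarith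
  have hRM : Real.exp (a * M) = R ^ 2 := by
    rw [haM, two_mul, Real.exp_add, Real.exp_log hR0, sq]
  have hγ : ρ ^ β + 2 * (16 / R * ρ ^ (1 + β)) ≤ γ := by
    have h1 : 32 * ρ ^ (1 + β) / (γ - ρ ^ β) ≤ R := by linarith
    rw [div_le_iff₀ hd] at h1
    have h2 : 2 * (16 / R * ρ ^ (1 + β)) = 32 * ρ ^ (1 + β) / R := by ring
    have h3 : 32 * ρ ^ (1 + β) / R ≤ γ - ρ ^ β := by
      rw [div_le_iff₀ hR0]; linarith
    linarith
  set ε := L / 100 with hεdef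
  have hε : 0 < ε := by positivity
  have hδβ : 0 < δ₀ ^ β := Real.rpow_pos_of_pos hδ₀ _
  have hγ1' : 0 < γ - 1 := by linarith
  have hγ0 : 0 < γ := by linarith
  obtain ⟨K, hK0, hK1, hK2, hK3⟩ : ∃ K : ℝ, 0 < K ∧ K / m ^ β + 2 * cs ≤ K / γ ∧
      ε ≤ K / γ * δ₀ ^ β ∧ ε ≤ K / γ := by
    have p1 : 0 < 2 * cs * γ ^ 2 / (γ - 1) := by positivity
    have p2 : 0 < ε * γ / δ₀ ^ β := by positivity
    have p3 : 0 < ε * γ := by positivity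
    refine ⟨2 * cs * γ ^ 2 / (γ - 1) + ε * γ / δ₀ ^ β + ε * γ, by positivity, ?_, ?_, ?_⟩
    · set K := 2 * cs * γ ^ 2 / (γ - 1) + ε * γ / δ₀ ^ β + ε * γ with hKdef
      have h1 : 2 * cs * γ ^ 2 / (γ - 1) ≤ K := by linarith
      rw [div_le_iff₀ hγ1'] at h1
      rw [hγ2, ← sub_nonneg]
      have e : K / γ - (K / γ ^ 2 + 2 * cs) = (K * (γ - 1) - 2 * cs * γ ^ 2) / γ ^ 2 := by
        field_simp
        ring
      rw [e]
      exact div_nonneg (by linarith) (by positivity)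
    · rw [div_mul_eq_mul_div, le_div_iff₀ hγ0, ← div_le_iff₀ hδβ]
      linarith
    · rw [le_div_iff₀ hγ0]; linarith
  have hεK : ε ≤ K := hK3.trans (div_le_self hK0.le hγ1.le)
  have hgrowth : ∀ n, GrowthBound ε M β K (Fbar n) := by
    intro n
    induction n with
    | zero =>
      intro y
      rw [rpow_one_add_of_nonneg ((hFD 0).2.2.1 y).1 hβ]
      have h0 := ((hFD 0).2.2.1 (y - M)).1
      rcases lt_or_ge y 0 with hy | hy
      · have h1 : Fbar 0 y = 1 := by simp [hF0, hy]
        have h2 : Fbar 0 (y - M) = 1 := by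
          rw [hF0, if_pos (by linarith)]
        rw [h1, h2, Real.one_rpow]; linarith
      · have h1 : Fbar 0 y = 0 := by simp [hF0, hy]
        rw [h1]; simpa using h0
    | succ n ih =>
      obtain ⟨hv, hF⟩ := hrec n
      have hvg : GrowthBound ε M β (K / γ) fun y => Q n (Fbar n y) := fun y =>
        growth_branching hδ₀ hm hcs hβ (min_le_left _ _) hε (by linarith) (hmono n) (hmaps n)
          (hexp n) (hratio n) hK0.le hK1 hK2 ((hFD n).2.2.1 y) ((hFD n).2.2.1 (y - M))
          ((hFD n).1 (by linarith)) (hQ0 n) (ih y)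
      have h := growthBound_convD (hGD n) (hG1 n) (hG1' n) (hG2 n) (hG3 n) hv hvg hε
        (by linarith) hβ (min_le_right _ _) hK3 hM hM₀ (by linarith) hρ hR16 hRM hγ
      rw [div_mul_cancel₀ K hγ0.ne'] at h
      rwa [show Fbar (n + 1) = convD (G n) (fun y => Q n (Fbar n y)) from funext hF]
  obtain ⟨δ, hδ0, hδ⟩ := exists_descends_of_growthBound hFD hgrowth hε hM.le hβ hK0
  refine tightAfterCentering_of_descends hFD fun κ hκ => ?_
  refine hδ.of_step hδ0 hQt.2.1 hQt.2.2.2.2.2.1 ?_ hκ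
  intro lam lam' hlam0 hlam1 hlam' hdesc
  refine hdesc.step hFD hQt.1 hQt.2.1 hQt.2.2.2.1 hlam0 hlam1 hlam'
    (hlam'.trans_le (hQt.2.2.1 ⟨hlam0.le, hlam1.le⟩).2) hF0 fun η₁ hη₁ => ?_
  obtain ⟨B, hB, hTB⟩ := hT η₁ hη₁
  refine ⟨B, hB, fun n x => ?_⟩
  rw [(hrec n).2 x]
  exact hTB n (Fbar n) _ (hFD n) (hrec n).1 (fun _ => rfl) x
end

section
/- Proposition 2.9. Let {F_n}_{n≥0} be distribution functions with F̄_n = 1 − F_n satisfying F̄_{n+1} = T_n F̄_n for maps T_n : 𝒟 → 𝒟. Suppose that there exist constants δ₁, M, ε₁ > 0 such that for all n and all x ∈ ℝ, F̄_n(x) ≤ δ₁ implies F̄_n(x − M) ≥ (1 + ε₁/2)·F̄_n(x), and suppose that the family {T_n} satisfies Assumption 2.4. Then the sequence of recentered distribution functions {F_n^s}_{n≥0} is tight after centering. -/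
open MeasureTheory Filter Set

/-- All functions `u n` pass from level `b` down to level `a` over a stretch of uniformly
bounded length. -/
def UniformLevelGap (u : ℕ → ℝ → ℝ) (a b : ℝ) : Prop :=
  ∃ C : ℝ, ∀ n x y, u n x < b → a < u n y → y - x ≤ C

lemma UniformLevelGap.mono_right {u : ℕ → ℝ → ℝ} {a b b' : ℝ} (h : UniformLevelGap u a b)
    (hb : b' ≤ b) : UniformLevelGap u a b' := by
  obtain ⟨C, hC⟩ := h
  exact ⟨C, fun n x y hx hy => hC n x y (hx.trans_le hb) hy⟩

lemma MemD.exists_level_gap {u : ℝ → ℝ} (hu : MemD u) {a b : ℝ} (ha : 0 < a) (hb : b < 1) :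
    ∃ C : ℝ, ∀ x y, u x < b → a < u y → y - x ≤ C := by
  obtain ⟨-, -, -, hbot, htop⟩ := hu
  obtain ⟨p, hp⟩ := eventually_atBot.1 (hbot.eventually (lt_mem_nhds hb))
  obtain ⟨q, hq⟩ := eventually_atTop.1 (htop.eventually (gt_mem_nhds ha))
  refine ⟨q - p, fun x y hx hy => ?_⟩
  have hpx : p < x := lt_of_not_ge fun h => (hp x h).not_gt hx
  have hyq : y < q := lt_of_not_ge fun h => (hq y h).not_gt hy
  linarith

/-- Geometric decay below level `δ` bounds the gaps below that level. -/
lemma uniformLevelGap_of_geometric_decay {u : ℕ → ℝ → ℝ} (hu : ∀ n, MemD (u n))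
    {δ M r a : ℝ} (hM : 0 < M) (hr : 1 < r) (ha : 0 < a)
    (hdecay : ∀ n x, u n x ≤ δ → r * u n x ≤ u n (x - M)) :
    UniformLevelGap u a δ := by
  obtain ⟨k, hk⟩ := pow_unbounded_of_one_lt (1 / a) hr
  have key : ∀ n x, u n x < δ → ∀ j : ℕ, r ^ j * u n (x + j * M) ≤ u n x := by
    intro n x hx j
    induction j with
    | zero => simp
    | succ j ih =>
      have hle : u n (x + (j + 1 : ℕ) * M) ≤ u n x := (hu n).1 (by
        have : 0 ≤ ((j + 1 : ℕ) : ℝ) * M := by positivity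
        linarith)
      have hstep := hdecay n _ (hle.trans hx.le)
      have hshift : x + (j + 1 : ℕ) * M - M = x + j * M := by push_cast; ring
      rw [hshift] at hstep
      calc r ^ (j + 1) * u n (x + (j + 1 : ℕ) * M)
          = r ^ j * (r * u n (x + (j + 1 : ℕ) * M)) := by ring
        _ ≤ r ^ j * u n (x + j * M) := by gcongr
        _ ≤ u n x := ih
  refine ⟨k * M, fun n x y hx hy => ?_⟩
  by_contra! hxy
  have hay : a < u n (x + k * M) := hy.trans_le ((hu n).1 (by linarith))
  have hle := (key n x hx k).trans ((hu n).2.2.1 x).2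
  rw [div_lt_iff₀ ha] at hk
  have : r ^ k * a < r ^ k * u n (x + k * M) := by gcongr
  linarith

/-- If `u (n + 1)` is comparable to `Q ∘ u n` up to shifts and small errors, then control of
the gaps below level `b'` propagates to all levels `b < Q b'`. -/
lemma UniformLevelGap.of_recursion {u : ℕ → ℝ → ℝ} (hu : ∀ n, MemD (u n)) {Q : ℝ → ℝ}
    (hmono : StrictMonoOn Q (Icc 0 1)) (hcont : ContinuousOn Q (Icc 0 1)) (hQ0 : Q 0 = 0)
    (hrec : ∀ η : ℝ, 0 < η → ∃ B : ℝ, ∀ n x,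
      Q (u n (x + B)) - η ≤ u (n + 1) x ∧ u (n + 1) x ≤ Q (u n (x - B)) + η)
    {b b' : ℝ} (hb' : b' ∈ Icc (0 : ℝ) 1) (hb1 : b < 1) (hbQ : b < Q b')
    (hgap : ∀ a : ℝ, 0 < a → UniformLevelGap u a b') {a : ℝ} (ha : 0 < a) :
    UniformLevelGap u a b := by
  obtain ⟨a', ha'0, ha'1, hQa'⟩ : ∃ a' : ℝ, 0 < a' ∧ a' ≤ 1 ∧ Q a' < a / 2 := by
    have h0 : Tendsto Q (nhdsWithin 0 (Icc 0 1)) (nhds 0) := by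
      simpa [ContinuousWithinAt, hQ0] using hcont 0 (by simp)
    have h1 : Tendsto Q (nhdsWithin 0 (Ioc 0 1)) (nhds 0) :=
      h0.mono_left (nhdsWithin_mono _ Ioc_subset_Icc_self)
    have : (nhdsWithin (0 : ℝ) (Ioc 0 1)).NeBot := by
      rw [nhdsWithin_Ioc_eq_nhdsGT one_pos]
      infer_instance
    obtain ⟨t, ht, ht'⟩ :=
      ((h1.eventually (gt_mem_nhds (half_pos ha))).and self_mem_nhdsWithin).exists
    exact ⟨t, ht'.1, ht'.2, ht⟩
  obtain ⟨B, hB⟩ := hrec (min (a / 2) (Q b' - b)) (lt_min (half_pos ha) (sub_pos.2 hbQ))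
  obtain ⟨C, hC⟩ := hgap a' ha'0
  obtain ⟨C₀, hC₀⟩ := (hu 0).exists_level_gap ha hb1
  have hη₁ := min_le_left (a / 2) (Q b' - b)
  have hη₂ := min_le_right (a / 2) (Q b' - b)
  refine ⟨max C₀ (C + 2 * B), fun n x y hx hy => ?_⟩
  cases n with
  | zero => exact (hC₀ x y hx hy).trans (le_max_left _ _)
  | succ n =>
    have hx' : u n (x + B) < b' :=
      (hmono.lt_iff_lt ((hu n).2.2.1 _) hb').1 (by linarith [(hB n x).1])
    have hy' : a' < u n (y - B) :=
      (hmono.lt_iff_lt ⟨ha'0.le, ha'1⟩ ((hu n).2.2.1 _)).1 (by linarith [(hB n y).2])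
    exact le_max_of_le_right (by linarith [hC n _ _ hx' hy'])

lemma MemD.apply_med_le {u : ℝ → ℝ} (hu : MemD u) : u (Med fun x => 1 - u x) ≤ 1 / 2 := by
  obtain ⟨hanti, hrc, -, -, htop⟩ := hu
  have hne : {x | 1 / 2 ≤ 1 - u x}.Nonempty := by
    obtain ⟨q, hq⟩ := (htop.eventually (gt_mem_nhds (by norm_num : (0 : ℝ) < 1 / 2))).exists
    exact ⟨q, by simp only [mem_ofPred_eq]; linarith⟩
  refine le_of_tendsto ((hrc _).mono_left (nhdsWithin_mono _ Ioi_subset_Ici_self)) ?_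
  filter_upwards [self_mem_nhdsWithin] with x hx
  obtain ⟨z, hz, hzx⟩ := exists_lt_of_csInf_lt hne hx
  simp only [mem_ofPred_eq] at hz
  have := hanti hzx.le
  linarith

lemma MemD.half_lt_of_lt_med {u : ℝ → ℝ} (hu : MemD u) {x : ℝ}
    (hx : x < Med fun x => 1 - u x) : 1 / 2 < u x := by
  obtain ⟨hanti, -, -, hbot, -⟩ := hu
  obtain ⟨p, hp⟩ := eventually_atBot.1
    (hbot.eventually (lt_mem_nhds (by norm_num : (1 / 2 : ℝ) < 1)))
  by_contra! h
  refine hx.not_ge (csInf_le ⟨p, fun z hz => ?_⟩ (by simp only [mem_ofPred_eq]; linarith))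
  simp only [mem_ofPred_eq] at hz
  exact le_of_not_ge fun hzp => by linarith [hp z hzp]

lemma tightAfterCentering_of_uniformLevelGap {u : ℕ → ℝ → ℝ} (hu : ∀ n, MemD (u n))
    (hgap : ∀ a b : ℝ, 0 < a → 0 < b → b < 1 → UniformLevelGap u a b) :
    TightAfterCentering fun n x => 1 - u n x := by
  intro ε hε
  set t := min (ε / 4) (1 / 4)
  have ht0 : 0 < t := by positivity
  have ht1 : t ≤ ε / 4 := min_le_left _ _
  have ht2 : t ≤ 1 / 4 := min_le_right _ _
  obtain ⟨C, hC⟩ := hgap t (1 - t) ht0 (by linarith) (by linarith)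
  refine ⟨|C| + 2, by positivity, fun n => ?_⟩
  have hCabs := le_abs_self C
  set m := Med fun x => 1 - u n x
  have hm : u n m ≤ 1 / 2 := (hu n).apply_med_le
  have hm' : 1 / 2 < u n (m - 1) := (hu n).half_lt_of_lt_med (sub_one_lt m)
  have hright : u n (|C| + 2 + m) ≤ t := by
    by_contra! h
    linarith [hC n m _ (by linarith) h]
  have hleft : 1 - t ≤ u n (-(|C| + 2) + m) := by
    by_contra! h
    linarith [hC n _ (m - 1) h (by linarith)]
  linarith

/-- Proposition 2.9: if the inequality (2.15) holds for all `n` under some choice of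
`δ₁, M, ε₁ > 0`, the operators `Tₙ : 𝒟 → 𝒟` satisfy Assumption 2.4, and
`F̄ₙ₊₁ = Tₙ F̄ₙ`, then the recentered distribution functions `{Fₙˢ}` are tight. -/
theorem tightness_from_flatness_bound
    (T : ℕ → (ℝ → ℝ) → (ℝ → ℝ))
    (hTD : ∀ n u, MemD u → MemD (T n u))
    (δ₁ M ε₁ : ℝ) (hδ₁ : 0 < δ₁) (hM : 0 < M) (hε₁ : 0 < ε₁)
    (Fbar : ℕ → ℝ → ℝ) (hFD : ∀ n, MemD (Fbar n))
    (hrec : ∀ n, Fbar (n + 1) = T n (Fbar n))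
    (h215 : ∀ (n : ℕ) (x : ℝ), Fbar n x ≤ δ₁ →
      (1 + ε₁ / 2) * Fbar n x ≤ Fbar n (x - M))
    (h24 : ∃ Qt : ℝ → ℝ, MemQt Qt ∧ ∀ η₁ : ℝ, 0 < η₁ → ∃ B : ℝ, 0 ≤ B ∧
      ∀ (n : ℕ) (u : ℝ → ℝ), MemD u → ∀ x : ℝ,
        Qt (u (x + B)) - η₁ ≤ T n u x ∧ T n u x ≤ Qt (u (x - B)) + η₁) :
    TightAfterCentering (fun n x => 1 - Fbar n x) := by
  obtain ⟨Qt, ⟨hmono, hcont, -, hQ0, -, -, hT1, -⟩, hT⟩ := h24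
  refine tightAfterCentering_of_uniformLevelGap hFD fun a b ha hb0 hb1 => ?_
  obtain ⟨c, hc1, hc⟩ := hT1 (1 - b) (by linarith)
  have hstep : ∀ η : ℝ, 0 < η → ∃ B : ℝ, ∀ n x, Qt (Fbar n (x + B)) - η ≤ Fbar (n + 1) x ∧
      Fbar (n + 1) x ≤ Qt (Fbar n (x - B)) + η := by
    intro η hη
    obtain ⟨B, -, hB⟩ := hT η hη
    exact ⟨B, fun n x => hrec n ▸ hB n (Fbar n) (hFD n) x⟩
  have hclimb : ∀ (k : ℕ) (a : ℝ), 0 < a → UniformLevelGap Fbar a (min b (c ^ k * δ₁)) := by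
    intro k
    induction k with
    | zero =>
      intro a ha
      exact (uniformLevelGap_of_geometric_decay hFD hM (by linarith) ha h215).mono_right
        (by simp)
    | succ k ih =>
      intro a ha
      rcases le_total b (c ^ k * δ₁) with h | h
      · exact (ih a ha).mono_right (by rw [min_eq_left h]; exact min_le_left _ _)
      · rw [min_eq_right h] at ih
        have hpos : 0 < c ^ k * δ₁ := by positivity
        refine UniformLevelGap.of_recursion hFD hmono hcont hQ0 hstep ⟨hpos.le, by linarith⟩
          ((min_le_left _ _).trans_lt hb1) ((min_le_right _ _).trans_lt ?_) ih ha
        calc c ^ (k + 1) * δ₁ = c * (c ^ k * δ₁) := by ring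
          _ < Qt (c ^ k * δ₁) := hc _ hpos (by linarith)
  obtain ⟨k, hk⟩ := pow_unbounded_of_one_lt (b / δ₁) hc1
  rw [div_lt_iff₀ hδ₁] at hk
  simpa [min_eq_left hk.le] using hclimb k a ha
end

section
/- Lemma 2.10. Let {F_n}_{n≥0} be distribution functions with F̄_n = 1 − F_n satisfying F̄_{n+1} = T_n F̄_n for maps T_n : 𝒟 → 𝒟 satisfying Assumption 2.4, and suppose there exist constants δ₁, M, ε₁ > 0 such that for all n and x, F̄_n(x) ≤ δ₁ implies F̄_n(x − M) ≥ (1 + ε₁/2)·F̄_n(x). Fix η₀ ∈ (0,1). Then there exist a constant γ = γ(η₀) < 1 and a continuous function f = f_{η₀} : [0,1] → [0,1] with f(t) → 0 as t → 0, such that for every ε ∈ (0, (1−η₀)/η₀), every η ∈ [δ₁, η₀], and every large enough N₁ = N₁(ε), the following holds: if M' ≥ M and for some n ≥ 1 and x ∈ ℝ one has F̄_n(x) > δ₁, F̄_n(x − M') ≤ (1 + ε)·F̄_n(x), and F̄_n(x − M') ≤ η, then F̄_{n−1}(x + N₁ − M') ≤ (1 + f(ε))·F̄_{n−1}(x − N₁)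 and F̄_{n−1}(x + N₁ − M') ≤ γ·η. -/
open MeasureTheory Filter Set

/-- A strictly increasing continuous function on `[0,1]` has a positive uniform increment over
steps of a given size. -/
lemma exists_uniform_increment {Q : ℝ → ℝ} (hmono : StrictMonoOn Q (Icc 0 1))
    (hcont : ContinuousOn Q (Icc 0 1)) {d : ℝ} (hd : 0 < d) :
    ∃ m : ℝ, 0 < m ∧ ∀ a ∈ Icc (0 : ℝ) 1, ∀ b ∈ Icc (0 : ℝ) 1, b + d ≤ a → Q b + m ≤ Q a := by
  by_cases h1 : d ≤ 1
  · have hc : ContinuousOn (fun b => Q (b + d) - Q b) (Icc 0 (1 - d)) := by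
      apply ContinuousOn.sub
      · refine hcont.comp (by fun_prop) ?_
        intro b hb
        exact ⟨by linarith [hb.1], by linarith [hb.2]⟩
      · refine hcont.mono ?_
        intro b hb
        exact ⟨hb.1, by linarith [hb.2]⟩
    obtain ⟨b₀, hb₀, hmin⟩ :=
      isCompact_Icc.exists_isMinOn (nonempty_Icc.2 (by linarith : (0 : ℝ) ≤ 1 - d)) hc
    refine ⟨Q (b₀ + d) - Q b₀, ?_, ?_⟩
    · have := hmono (a := b₀) (b := b₀ + d) ⟨hb₀.1, by linarith [hb₀.2]⟩
        ⟨by linarith [hb₀.1], by linarith [hb₀.2]⟩ (by linarith)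
      linarith
    · intro a ha b hb hab
      have hle : Q (b₀ + d) - Q b₀ ≤ Q (b + d) - Q b :=
        hmin (show b ∈ Icc 0 (1 - d) from ⟨hb.1, by linarith [ha.2]⟩)
      have := hmono.monotoneOn (a := b + d) (b := a)
        ⟨by linarith [hb.1], by linarith [ha.2]⟩ ha hab
      linarith
  · refine ⟨1, one_pos, ?_⟩
    intro a ha b hb hab
    linarith [ha.2, hb.1]

/-- The two-sided comparison of `F (n + 1)` with `Q ∘ F n` up to a spatial shift. -/
def ShiftComparable (Q : ℝ → ℝ) (F : ℕ → ℝ → ℝ) : Prop :=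
  ∀ e : ℝ, 0 < e → ∃ B : ℝ, 0 ≤ B ∧ ∀ (n : ℕ) (x : ℝ),
    Q (F n (x + B)) - e ≤ F (n + 1) x ∧ F (n + 1) x ≤ Q (F n (x - B)) + e

lemma MemQt.le_apply {Q : ℝ → ℝ} (hQ : MemQt Q) {x : ℝ} (hx : x ∈ Icc (0 : ℝ) 1) : x ≤ Q x := by
  obtain ⟨-, -, -, h0, h1, hT, -⟩ := hQ
  rcases hx.1.eq_or_lt with rfl | hx0
  · exact h0.ge
  rcases hx.2.eq_or_lt with rfl | hx1
  · exact h1.ge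
  · exact (hT x hx0 hx1).le

/-- Going back one step decreases the level by a fixed factor. -/
lemma exists_level_contraction {Q : ℝ → ℝ} (hQ : MemQt Q) {F : ℕ → ℝ → ℝ}
    (hF : ∀ n, MemD (F n)) (hQF : ShiftComparable Q F) {δ η₀ : ℝ} (hδ : 0 < δ) (hη₀ : η₀ < 1) :
    ∃ γ : ℝ, 0 < γ ∧ γ < 1 ∧ ∃ B : ℝ, 0 ≤ B ∧ ∀ N : ℝ, B ≤ N → ∀ η : ℝ, δ ≤ η → η ≤ η₀ →
      ∀ (n : ℕ) (y : ℝ), F (n + 1) y ≤ η → F n (y + N) ≤ γ * η := by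
  obtain ⟨c, hc, hcQ⟩ := hQ.2.2.2.2.2.2.1 ((1 - η₀) / 2) (by linarith)
  have hc0 : 0 < c := by linarith
  obtain ⟨B, hB, hBF⟩ := hQF (min (δ * (c - 1) / 2) ((1 - η₀) / 2))
    (lt_min (by have := mul_pos hδ (sub_pos.2 hc); linarith) (by linarith))
  refine ⟨(1 + c) / (2 * c), by positivity, by rw [div_lt_one (by positivity)]; linarith,
    B, hB, ?_⟩
  intro N hN η hδη hηη₀ n y hy
  have he1 := min_le_left (δ * (c - 1) / 2) ((1 - η₀) / 2)
  have he2 := min_le_right (δ * (c - 1) / 2) ((1 - η₀) / 2)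
  have hs := (hBF n y).1
  have hanti : F n (y + N) ≤ F n (y + B) := (hF n).1 (by linarith)
  have hmem := (hF n).2.2.1 (y + B)
  refine hanti.trans ?_
  rcases hmem.1.eq_or_lt with h0 | hpos
  · rw [← h0]
    have : 0 < η := by linarith
    positivity
  have hcq := hcQ _ hpos (by linarith [hQ.le_apply hmem])
  have hmul : δ * (c - 1) ≤ η * (c - 1) := mul_le_mul_of_nonneg_right hδη (by linarith)
  rw [div_mul_eq_mul_div, le_div_iff₀ (by positivity)]
  linarith

/-- Going back one step, the ratio of values across a flat stretch stays close to one. -/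
lemma exists_ratio_control {Q : ℝ → ℝ} (hQ : MemQt Q) {F : ℕ → ℝ → ℝ}
    (hF : ∀ n, MemD (F n)) (hQF : ShiftComparable Q F) {δ r : ℝ} (hδ : 0 < δ) (hr : 0 < r) :
    ∃ ε : ℝ, 0 < ε ∧ ∃ B : ℝ, 0 ≤ B ∧ ∀ N : ℝ, B ≤ N → ∀ (n : ℕ) (y x : ℝ),
      δ < F (n + 1) x → F (n + 1) y ≤ (1 + ε) * F (n + 1) x →
        0 < F n (x - N) ∧ F n (y + N) ≤ (1 + r) * F n (x - N) := by
  obtain ⟨hmono, hcont, -, h0, -⟩ := id hQ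
  obtain ⟨b₀, hb₀, hb₀1, hQb₀⟩ : ∃ b₀ : ℝ, 0 < b₀ ∧ b₀ ≤ 1 ∧ Q b₀ < δ / 2 := by
    have hev : ∀ᶠ x in nhdsWithin (0 : ℝ) (Icc 0 1), Q x < δ / 2 :=
      (hcont 0 (by simp)).eventually_lt_const (by rw [h0]; linarith)
    rw [Filter.Eventually, Metric.mem_nhdsWithin_iff] at hev
    obtain ⟨s, hs, hsub⟩ := hev
    refine ⟨min (s / 2) 1, by positivity, min_le_right _ _, hsub ⟨?_, ?_, min_le_right _ _⟩⟩
    · rw [Metric.mem_ball, Real.dist_eq, sub_zero, abs_of_pos (by positivity)]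
      linarith [min_le_left (s / 2) 1]
    · positivity
  obtain ⟨m, hm, hinc⟩ := exists_uniform_increment hmono hcont (mul_pos hr hb₀)
  obtain ⟨B, hB, hBF⟩ := hQF (min (δ / 2) (m / 4)) (by positivity)
  refine ⟨m / 4, by positivity, B, hB, ?_⟩
  intro N hN n y x hx hyx
  have he1 := min_le_left (δ / 2) (m / 4)
  have he2 := min_le_right (δ / 2) (m / 4)
  have ha := (hF n).2.2.1 (y + N)
  have hb := (hF n).2.2.1 (x - N)
  have hsa : Q (F n (y + N)) ≤ Q (F n (y + B)) :=
    hmono.monotoneOn ha ((hF n).2.2.1 _) ((hF n).1 (by linarith))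
  have hsb : Q (F n (x - B)) ≤ Q (F n (x - N)) :=
    hmono.monotoneOn ((hF n).2.2.1 _) hb ((hF n).1 (by linarith))
  have h1 := (hBF n y).1
  have h2 := (hBF n x).2
  have hbb : b₀ < F n (x - N) := by
    rw [← hmono.lt_iff_lt ⟨hb₀.le, hb₀1⟩ hb]
    linarith
  refine ⟨hb₀.trans hbb, ?_⟩
  by_contra! hcon
  have hrb : r * b₀ ≤ r * F n (x - N) := mul_le_mul_of_nonneg_left hbb.le hr.le
  have := hinc _ ha _ hb (by linarith)
  have hle : m / 4 * F (n + 1) x ≤ m / 4 :=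
    mul_le_of_le_one_right (by positivity) ((hF (n + 1)).2.2.1 x).2
  linarith

/-- `F n` is eventually (in `n`) non-flat below the level `η`. -/
def NonflatBelow (F : ℕ → ℝ → ℝ) (η : ℝ) : Prop :=
  ∃ ε : ℝ, 0 < ε ∧ ∃ L : ℝ, 0 ≤ L ∧ ∃ K : ℕ, ∀ n, K ≤ n → ∀ y x : ℝ, y + L ≤ x →
    F n y ≤ η → 0 < F n x → (1 + ε) * F n x < F n y

lemma nonflatBelow_of_le {F : ℕ → ℝ → ℝ} (hF : ∀ n, MemD (F n)) {δ M ε₁ : ℝ} (hM : 0 < M)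
    (hε₁ : 0 < ε₁)
    (hflat : ∀ (n : ℕ) (x : ℝ), F n x ≤ δ → (1 + ε₁ / 2) * F n x ≤ F n (x - M))
    {η : ℝ} (hη : η ≤ δ) : NonflatBelow F η := by
  refine ⟨ε₁ / 4, by positivity, M, hM.le, 0, ?_⟩
  intro n _ y x hyx hy hx
  have h1 : F n x ≤ F n y := (hF n).1 (by linarith)
  have h2 : F n (x - M) ≤ F n y := (hF n).1 (by linarith)
  have h3 := hflat n x (by linarith)
  have := mul_pos hε₁ hx
  linarith

lemma nonflatBelow_of_lt_one {Q : ℝ → ℝ} (hQ : MemQt Q) {F : ℕ → ℝ → ℝ}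
    (hF : ∀ n, MemD (F n)) (hQF : ShiftComparable Q F) {δ M ε₁ : ℝ} (hδ : 0 < δ) (hM : 0 < M)
    (hε₁ : 0 < ε₁)
    (hflat : ∀ (n : ℕ) (x : ℝ), F n x ≤ δ → (1 + ε₁ / 2) * F n x ≤ F n (x - M))
    {η₀ : ℝ} (hη₀ : η₀ < 1) : NonflatBelow F η₀ := by
  obtain ⟨γ, hγ0, hγ1, B₁, hB₁, hlevel⟩ := exists_level_contraction hQ hF hQF hδ hη₀
  have key : ∀ (k : ℕ) (η : ℝ), η ≤ η₀ → γ ^ k * η ≤ δ → NonflatBelow F η := by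
    intro k
    induction k with
    | zero =>
      intro η _ h
      exact nonflatBelow_of_le hF hM hε₁ hflat (by simpa using h)
    | succ k ih =>
      intro η hη hk
      rcases le_total η δ with hηδ | hδη
      · exact nonflatBelow_of_le hF hM hε₁ hflat hηδ
      have hγη : γ * η ≤ η := mul_le_of_le_one_left (by linarith) hγ1.le
      obtain ⟨r, hr, L, hL, K, hK⟩ := ih (γ * η) (hγη.trans hη) (by rwa [← mul_assoc, ← pow_succ])
      obtain ⟨ε, hε, B₂, hB₂, hratio⟩ := exists_ratio_control hQ hF hQF hδ hr
      have hN1 := le_max_left B₁ B₂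
      have hN2 := le_max_right B₁ B₂
      have hL1 := le_max_left M (L + 2 * max B₁ B₂)
      have hL2 := le_max_right M (L + 2 * max B₁ B₂)
      refine ⟨min ε (ε₁ / 4), by positivity, max M (L + 2 * max B₁ B₂), by linarith, K + 1, ?_⟩
      intro n hn y x hyx hy hx
      obtain ⟨n, rfl⟩ : ∃ k, n = k + 1 := ⟨n - 1, by omega⟩
      rcases le_or_gt (F (n + 1) x) δ with hxδ | hxδ
      · have h2 : F (n + 1) (x - M) ≤ F (n + 1) y := (hF _).1 (by linarith)
        have h3 := hflat _ x hxδ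
        have h4 : min ε (ε₁ / 4) * F (n + 1) x ≤ ε₁ / 4 * F (n + 1) x :=
          mul_le_mul_of_nonneg_right (min_le_right _ _) hx.le
        have := mul_pos hε₁ hx
        linarith
      · by_contra! hcon
        have h4 : min ε (ε₁ / 4) * F (n + 1) x ≤ ε * F (n + 1) x :=
          mul_le_mul_of_nonneg_right (min_le_left _ _) hx.le
        obtain ⟨hpos, hle⟩ := hratio _ hN2 n y x hxδ (by linarith)
        have hlt := hK n (by omega) (y + max B₁ B₂) (x - max B₁ B₂) (by linarith)
          (hlevel _ hN1 η hδη hη n y hy) hpos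
        linarith
  obtain ⟨k, hk⟩ := exists_pow_lt_of_lt_one hδ hγ1
  refine key k η₀ le_rfl ?_
  have : γ ^ k * η₀ ≤ γ ^ k := mul_le_of_le_one_right (by positivity) hη₀.le
  linarith

/-- Uniform bound on the distance between two levels of `F n`. -/
lemma exists_level_distance_bound {F : ℕ → ℝ → ℝ} (hF : ∀ n, MemD (F n)) {δ η₀ : ℝ} (hδ : 0 < δ)
    (hη₀ : η₀ < 1) (hnf : NonflatBelow F η₀) :
    ∃ L : ℝ, ∀ (n : ℕ) (y x : ℝ), y + L ≤ x → δ < F n x → η₀ < F n y := by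
  obtain ⟨ε, hε, L, hL, K, hK⟩ := hnf
  have hfin : ∃ L' : ℝ, ∀ n < K, ∀ y x : ℝ, y + L' ≤ x → δ < F n x → η₀ < F n y := by
    have hsingle : ∀ n, ∃ A : ℝ, ∀ y x : ℝ, y + A ≤ x → δ < F n x → η₀ < F n y := by
      intro n
      obtain ⟨p, hp⟩ := eventually_atBot.1 ((hF n).2.2.2.1.eventually_const_lt hη₀)
      obtain ⟨q, hq⟩ := eventually_atTop.1 ((hF n).2.2.2.2.eventually_lt_const hδ)
      refine ⟨q - p, fun y x hyx hx => hp y ?_⟩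
      by_contra! hpy
      exact (hq x (by linarith)).not_gt hx
    choose A hA using hsingle
    obtain ⟨C, hC⟩ := ((Finset.range K).image A).bddAbove
    refine ⟨C, fun n hn y x hyx hx => hA n y x ?_ hx⟩
    have : A n ≤ C := hC (by
      simp only [Finset.coe_image, Finset.coe_range]
      exact mem_image_of_mem A hn)
    linarith
  obtain ⟨L', hL'⟩ := hfin
  obtain ⟨k, hk⟩ := pow_unbounded_of_one_lt (1 / δ) (by linarith : 1 < 1 + ε)
  refine ⟨max L' (k * L), fun n y x hyx hx => ?_⟩
  have hm1 := le_max_left L' (k * L)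
  have hm2 := le_max_right L' (k * L)
  rcases lt_or_ge n K with hn | hn
  · exact hL' n hn y x (by linarith) hx
  by_contra! hcon
  have hx0 : 0 < F n x := hδ.trans hx
  have hiter : ∀ j : ℕ, y + j * L ≤ x → (1 + ε) ^ j * F n x ≤ F n (x - j * L) := by
    intro j
    induction j with
    | zero => simp
    | succ j ih =>
      intro hj
      push_cast at hj ⊢
      have hjL : 0 ≤ (j : ℝ) * L := by positivity
      have hle : F n (x - (j + 1) * L) ≤ η₀ := ((hF n).1 (by linarith)).trans hcon
      have hpos : 0 < F n (x - j * L) := hx0.trans_le ((hF n).1 (by linarith))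
      have h1 := hK n hn (x - (j + 1) * L) (x - j * L) (by linarith) hle hpos
      have h2 := mul_le_mul_of_nonneg_left (ih (by linarith)) (by linarith : 0 ≤ 1 + ε)
      rw [pow_succ']
      linarith
  have h1 := hiter k (by linarith)
  have h2 := ((hF n).2.2.1 (x - k * L)).2
  rw [div_lt_iff₀ hδ] at hk
  have h3 := mul_lt_mul_of_pos_left hx (by positivity : 0 < (1 + ε) ^ k)
  linarith

/-- Lemma 2.10: under (2.15) and Assumption 2.4, for fixed `η₀ ∈ (0,1)` there exist
`γ = γ(η₀) < 1` and a continuous `f = f_{η₀} : [0,1] → [0,1]` with `f(t) → 0` as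
`t → 0`, such that for every `ε ∈ (0, (1-η₀)/η₀)`, every `η ∈ [δ₁, η₀]` and every
large enough `N₁ = N₁(ε)`: if `M' ≥ M`, `F̄ₙ(x) > δ₁`,
`F̄ₙ(x - M') ≤ (1+ε) F̄ₙ(x)` and `F̄ₙ(x - M') ≤ η`, then
`F̄ₙ₋₁(x + N₁ - M') ≤ (1 + f(ε)) F̄ₙ₋₁(x - N₁)` and `F̄ₙ₋₁(x + N₁ - M') ≤ γ η`. -/
theorem flatness_propagates_backwards
    (T : ℕ → (ℝ → ℝ) → (ℝ → ℝ))
    (hTD : ∀ n u, MemD u → MemD (T n u))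
    (δ₁ M ε₁ : ℝ) (hδ₁ : 0 < δ₁) (hM : 0 < M) (hε₁ : 0 < ε₁)
    (Fbar : ℕ → ℝ → ℝ) (hFD : ∀ n, MemD (Fbar n))
    (hrec : ∀ n, Fbar (n + 1) = T n (Fbar n))
    (h215 : ∀ (n : ℕ) (x : ℝ), Fbar n x ≤ δ₁ →
      (1 + ε₁ / 2) * Fbar n x ≤ Fbar n (x - M))
    (h24 : ∃ Qt : ℝ → ℝ, MemQt Qt ∧ ∀ η₁ : ℝ, 0 < η₁ → ∃ B : ℝ, 0 ≤ B ∧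
      ∀ (n : ℕ) (u : ℝ → ℝ), MemD u → ∀ x : ℝ,
        Qt (u (x + B)) - η₁ ≤ T n u x ∧ T n u x ≤ Qt (u (x - B)) + η₁)
    (η₀ : ℝ) (hη₀ : 0 < η₀) (hη₀1 : η₀ < 1) :
    ∃ γ : ℝ, γ < 1 ∧ ∃ f : ℝ → ℝ,
      ContinuousOn f (Set.Icc 0 1) ∧
      (∀ t ∈ Set.Icc (0 : ℝ) 1, f t ∈ Set.Icc (0 : ℝ) 1) ∧
      Filter.Tendsto f (nhdsWithin 0 (Set.Ioi 0)) (nhds 0) ∧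
      ∀ ε : ℝ, 0 < ε → ε < (1 - η₀) / η₀ →
        ∃ N₀ : ℝ, ∀ N₁ : ℝ, N₀ ≤ N₁ →
          ∀ η : ℝ, δ₁ ≤ η → η ≤ η₀ →
            ∀ M' : ℝ, M ≤ M' →
              ∀ (n : ℕ) (x : ℝ),
                δ₁ < Fbar (n + 1) x →
                Fbar (n + 1) (x - M') ≤ (1 + ε) * Fbar (n + 1) x →
                Fbar (n + 1) (x - M') ≤ η →
                Fbar n (x + N₁ - M') ≤ (1 + f ε) * Fbar n (x - N₁) ∧
                  Fbar n (x + N₁ - M') ≤ γ * η := by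
  obtain ⟨Q, hQ, hsand⟩ := h24
  have hQF : ShiftComparable Q Fbar := by
    intro e he
    obtain ⟨B, hB, h⟩ := hsand e he
    refine ⟨B, hB, fun n x => ?_⟩
    rw [hrec n]
    exact h n (Fbar n) (hFD n) x
  obtain ⟨γ, -, hγ1, B, hB, hlevel⟩ := exists_level_contraction hQ hFD hQF hδ₁ hη₀1
  obtain ⟨L, hL⟩ := exists_level_distance_bound hFD hδ₁ hη₀1
    (nonflatBelow_of_lt_one hQ hFD hQF hδ₁ hM hε₁ h215 hη₀1)
  refine ⟨γ, hγ1, fun _ => 0, continuousOn_const, by simp, tendsto_const_nhds, ?_⟩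
  intro ε _ _
  refine ⟨max B (L / 2), fun N₁ hN₁ η hη hηη₀ M' _ n x hx _ hy => ⟨?_, ?_⟩⟩
  · have hM'L : M' < L := by
      by_contra! h
      exact (hL (n + 1) (x - M') x (by linarith) hx).not_ge (hy.trans hηη₀)
    have := le_max_right B (L / 2)
    rw [add_zero, one_mul]
    exact (hFD n).1 (by linarith)
  · rw [show x + N₁ - M' = x - M' + N₁ by ring]
    exact hlevel N₁ ((le_max_left _ _).trans hN₁) η hη hηη₀ n (x - M') hy
end

section
/- Lemma 3.4. Let {Q_n} satisfy Assumption 2.1 with constants δ₀, m, c*, θ*. Then for all sufficiently small δ₀ > 0 the following holds: if 0 < x₁ < x₂ satisfy Q_n(x₁) ≤ δ₀ and Q_n(x₂) ≤ (3/2)·Q_n(x₁), then x₂/x₁ ≤ (Q_n(x₂)/Q_n(x₁))·(1 + c*·(Q_n(x₁))^{θ*}). -/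
open Set

/-- Lemma 3.4: under Assumption 2.1, for all sufficiently small thresholds `δ₂ > 0`:
if `0 < x₁ < x₂` satisfy `Qₙ(x₁) ≤ δ₂` and `Qₙ(x₂) ≤ (3/2) Qₙ(x₁)`, then
`x₂/x₁ ≤ (Qₙ(x₂)/Qₙ(x₁)) (1 + c* (Qₙ(x₁))^{θ*})`. -/
theorem ratio_bound_without_doubling
    (Q : ℕ → ℝ → ℝ) (δ₀ m cs θs : ℝ) (hQ : Assumption21 Q δ₀ m cs θs) :
    ∃ δ₂ : ℝ, 0 < δ₂ ∧
      ∀ (n : ℕ) (x₁ x₂ : ℝ), 0 < x₁ → x₁ < x₂ → x₂ ≤ 1 →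
        Q n x₁ ≤ δ₂ → Q n x₂ ≤ (3 / 2) * Q n x₁ →
        x₂ / x₁ ≤ (Q n x₂ / Q n x₁) * (1 + cs * (Q n x₁) ^ θs) := by
  obtain ⟨hδ, hm, -, hc, hθ, hmono, -, -, -, hgrow, hratio⟩ := hQ
  have hε : 0 < 1 / (4 * cs) := by positivity
  refine ⟨min δ₀ ((1 / (4 * cs)) ^ θs⁻¹), lt_min hδ (by positivity), ?_⟩
  intro n x₁ x₂ hx₁ hx₁₂ hx₂ hQ₁ hQ₂
  have hQδ : Q n x₁ ≤ δ₀ := hQ₁.trans (min_le_left _ _)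
  have hx₁δ : x₁ ≤ 2 * δ₀ := by
    by_contra! hlt
    have hlow := hgrow n (2 * δ₀) (by positivity) le_rfl
    have hle := hmono n ⟨by positivity, by linarith⟩ ⟨hx₁.le, by linarith⟩ hlt.le
    nlinarith
  have hlow := hgrow n x₁ hx₁.le hx₁δ
  have hQpos : 0 < Q n x₁ := lt_of_lt_of_le (by positivity) hlow
  have hx₁δ' : x₁ ≤ δ₀ := by nlinarith
  rcases le_or_gt x₂ (2 * x₁) with hle | hlt
  · exact hratio n x₁ x₂ hx₁ hx₁₂ (by rwa [min_eq_right hx₁δ'])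
  · exfalso
    have hdouble := hratio n x₁ (2 * x₁) hx₁ (by linarith) (by rw [min_eq_right hx₁δ'])
    rw [mul_div_assoc, div_self hx₁.ne', mul_one] at hdouble
    have hle := hmono n ⟨by positivity, by linarith⟩ ⟨by linarith, hx₂⟩ hlt.le
    have hquot : Q n (2 * x₁) / Q n x₁ ≤ 3 / 2 := by
      rw [div_le_iff₀ hQpos]
      exact hle.trans hQ₂
    have hpow : (Q n x₁) ^ θs ≤ 1 / (4 * cs) :=
      (Real.rpow_le_rpow hQpos.le (hQ₁.trans (min_le_right _ _)) hθ.le).trans_eq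
        (Real.rpow_inv_rpow hε.le hθ.ne')
    have hsmall : cs * (Q n x₁) ^ θs ≤ 1 / 4 := by
      rw [le_div_iff₀ (by positivity)] at hpow
      linarith
    have hnonneg : 0 ≤ cs * (Q n x₁) ^ θs := by positivity
    nlinarith
end

section
/- Theorem 1.1 (recursion form for the maximal displacement of branching random walk). Let {p_k}_{k≥1} be a probability distribution on the positive integers with p₁ < 1 and ∑_{k≥1} k^θ p_k < ∞ for some θ ∈ (1,2], and set Q(u) = 1 − ∑_{k≥1} p_k·(1−u)^k for u ∈ [0,1]. Let G be a distribution function on ℝ with Ḡ = 1 − G satisfying: there exist a > 0 and M₀ > 0 such that Ḡ(x + M) ≤ e^{−aM}·Ḡ(x) for all x ≥ 0 and M ≥ M₀. Define distribution functions {F_n}_{n≥0} by F̄₀(x) = 1_{x < 0} and F̄_{n+1}(x) = −∫_ℝ Ḡ(x − y) dQ(F̄_n(y)) (Lebesgue–Stieltjes integral with respect to the nonincreasing function y ↦ Q(F̄_n(y))). Then the sequence {F_n^s}_{n≥0} is tight after centering; equivalently, the medians-centered maximal displacements {M_n − Med(F_n)}_{n≥0} of the branching random walk form a tight sequence of random variables.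 -/
open MeasureTheory Filter Set

/-- The upper tail of a probability measure on `ℝ` belongs to `𝒟`. -/
lemma memD_measureReal_Ioi (P : Measure ℝ) [IsProbabilityMeasure P] :
    MemD fun x => P.real (Ioi x) := by
  have h : (fun x => P.real (Ioi x)) = fun x => 1 - ProbabilityTheory.cdf P x := by
    funext x
    rw [ProbabilityTheory.cdf_eq_real, ← probReal_compl_eq_one_sub measurableSet_Iic, compl_Iic]
  rw [h]
  refine ⟨fun x y hxy => ?_, fun x => ?_, fun x => ?_, ?_, ?_⟩
  · exact sub_le_sub_left (ProbabilityTheory.monotone_cdf P hxy) 1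
  · exact continuousWithinAt_const.sub ((ProbabilityTheory.cdf P).right_continuous x)
  · have h0 := ProbabilityTheory.cdf_nonneg P x
    have h1 := ProbabilityTheory.cdf_le_one P x
    exact ⟨by linarith, by linarith⟩
  · simpa using (ProbabilityTheory.tendsto_cdf_atBot P).const_sub 1
  · simpa using (ProbabilityTheory.tendsto_cdf_atTop P).const_sub 1

/-- The measure `-du` of a function `u` of class `𝒟` is the probability measure with tail `u`. -/
lemma MemD.lsMeasure_spec {u : ℝ → ℝ} (hu : MemD u) :
    IsProbabilityMeasure (lsMeasure u) ∧ ∀ x, (lsMeasure u).real (Ioi x) = u x := by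
  obtain ⟨hanti, hcont, hI, hbot, htop⟩ := hu
  have hcond : Monotone (fun x => 1 - u x) ∧
      ∀ x, ContinuousWithinAt (fun x => 1 - u x) (Set.Ici x) x :=
    ⟨fun x y hxy => sub_le_sub_left (hanti hxy) 1, fun x => continuousWithinAt_const.sub (hcont x)⟩
  have hbot' : Tendsto (fun x => 1 - u x) atBot (nhds 0) := by simpa using hbot.const_sub 1
  have htop' : Tendsto (fun x => 1 - u x) atTop (nhds 1) := by simpa using htop.const_sub 1
  have heq : lsMeasure u = StieltjesFunction.measure ⟨fun x => 1 - u x, hcond.1, hcond.2⟩ := by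
    rw [lsMeasure, dif_pos hcond]
  rw [heq]
  refine ⟨StieltjesFunction.isProbabilityMeasure _ hbot' htop', fun x => ?_⟩
  rw [measureReal_def, StieltjesFunction.measure_Ioi _ htop' x]
  have h : (1 : ℝ) - (1 - u x) = u x := by ring
  change (ENNReal.ofReal (1 - (1 - u x))).toReal = u x
  rw [h, ENNReal.toReal_ofReal (hI x).1]

/-- Tonelli's theorem for the event `{X ∈ S, X + Y > x}`. -/
lemma setIntegral_measureReal_Ioi_sub (μ ν : Measure ℝ) [IsProbabilityMeasure μ]
    [IsProbabilityMeasure ν] (S : Set ℝ) (x : ℝ) :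
    ∫ t in S, ν.real (Ioi (x - t)) ∂μ = ∫ y, μ.real (S ∩ Ioi (x - y)) ∂ν := by
  have hE : MeasurableSet {q : ℝ × ℝ | x < q.1 + q.2} :=
    measurableSet_lt measurable_const (measurable_fst.add measurable_snd)
  have h1 : ∀ t, Prod.mk t ⁻¹' {q : ℝ × ℝ | x < q.1 + q.2} = Ioi (x - t) := by
    intro t; ext y; simp [sub_lt_iff_lt_add']
  have h2 : ∀ y, (fun t => (t, y)) ⁻¹' {q : ℝ × ℝ | x < q.1 + q.2} = Ioi (x - y) := by
    intro y; ext t; simp [sub_lt_iff_lt_add]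
  have e1 := Measure.prod_apply (μ := μ.restrict S) (ν := ν) hE
  have e2 := Measure.prod_apply_symm (μ := μ.restrict S) (ν := ν) hE
  simp only [h1] at e1
  simp only [h2, Measure.restrict_apply measurableSet_Ioi] at e2
  have m1 : Measurable fun t => ν (Ioi (x - t)) := by
    simpa only [h1] using measurable_measure_prodMk_left (ν := ν) hE
  have m2 : Measurable fun y => μ (S ∩ Ioi (x - y)) := by
    have := measurable_measure_prodMk_right (μ := μ.restrict S) hE
    simp only [h2, Measure.restrict_apply measurableSet_Ioi] at this
    simpa only [inter_comm S] using this
  simp only [measureReal_def]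
  rw [integral_toReal m1.aemeasurable (by simp), integral_toReal m2.aemeasurable (by simp), ← e1,
    e2]
  simp only [inter_comm S]

lemma integrable_of_mem_Icc {μ : Measure ℝ} [IsFiniteMeasure μ] {f : ℝ → ℝ} (hf : Measurable f)
    (h : ∀ x, f x ∈ Icc (0 : ℝ) 1) : Integrable f μ :=
  Integrable.of_bound hf.aestronglyMeasurable 1 (Eventually.of_forall fun x => by
    rw [Real.norm_eq_abs, abs_of_nonneg (h x).1]; exact (h x).2)

lemma MemD.integrable_comp_sub {w : ℝ → ℝ} (hw : MemD w) (μ : Measure ℝ) [IsFiniteMeasure μ]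
    (x : ℝ) : Integrable (fun t => w (x - t)) μ :=
  integrable_of_mem_Icc (hw.1.measurable.comp (measurable_const.sub measurable_id))
    fun _ => hw.2.2.1 _

/-- Convolving with a probability measure, written on either side, preserves the class `𝒟`. -/
lemma MemD.convolution {w : ℝ → ℝ} (hw : MemD w) (μ : Measure ℝ) [IsProbabilityMeasure μ] :
    (∀ x, ∫ y, μ.real (Ioi (x - y)) ∂(lsMeasure w) = ∫ t, w (x - t) ∂μ) ∧
      MemD fun x => ∫ t, w (x - t) ∂μ := by
  obtain ⟨hP, hT⟩ := hw.lsMeasure_spec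
  have key : ∀ x, ∫ y, μ.real (Ioi (x - y)) ∂(lsMeasure w) = ∫ t, w (x - t) ∂μ := by
    intro x
    have := setIntegral_measureReal_Ioi_sub μ (lsMeasure w) univ x
    simp only [Measure.restrict_univ, univ_inter, hT] at this
    exact this.symm
  refine ⟨key, ?_⟩
  have hprob : IsProbabilityMeasure ((μ.prod (lsMeasure w)).map fun q => q.1 + q.2) :=
    Measure.isProbabilityMeasure_map (measurable_fst.add measurable_snd).aemeasurable
  convert memD_measureReal_Ioi ((μ.prod (lsMeasure w)).map fun q => q.1 + q.2) using 2 with x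
  have hE : MeasurableSet {q : ℝ × ℝ | x < q.1 + q.2} :=
    measurableSet_lt measurable_const (measurable_fst.add measurable_snd)
  have h1 : ∀ t, Prod.mk t ⁻¹' {q : ℝ × ℝ | x < q.1 + q.2} = Ioi (x - t) := by
    intro t; ext y; simp [sub_lt_iff_lt_add']
  have hadd : Measurable fun q : ℝ × ℝ => q.1 + q.2 := measurable_fst.add measurable_snd
  rw [measureReal_def, Measure.map_apply hadd measurableSet_Ioi]
  change _ = ((μ.prod (lsMeasure w)) {q : ℝ × ℝ | x < q.1 + q.2}).toReal
  have m1 : Measurable fun t => (lsMeasure w) (Ioi (x - t)) := by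
    simpa only [h1] using measurable_measure_prodMk_left (ν := lsMeasure w) hE
  rw [Measure.prod_apply hE]
  simp only [h1]
  rw [← integral_toReal m1.aemeasurable (by simp)]
  exact integral_congr_ae (Eventually.of_forall fun t => (hT _).symm)

/-- Stochastic domination coming from the exponential decay of the tail of `μ`. -/
lemma MemD.setIntegral_Ioi_add_le {w : ℝ → ℝ} (hw : MemD w) {μ : Measure ℝ}
    [IsProbabilityMeasure μ] {a M₀ : ℝ}
    (htail : ∀ x M : ℝ, 0 ≤ x → M₀ ≤ M →
      μ.real (Ioi (x + M)) ≤ Real.exp (-(a * M)) * μ.real (Ioi x))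
    {t k : ℝ} (ht : 0 ≤ t) (hk : M₀ ≤ k) (x : ℝ) :
    ∫ s in Ioi (t + k), w (x - s) ∂μ ≤
      Real.exp (-(a * k)) * ∫ s in Ioi t, w (x - k - s) ∂μ := by
  obtain ⟨hP, hT⟩ := hw.lsMeasure_spec
  have e1 := setIntegral_measureReal_Ioi_sub μ (lsMeasure w) (Ioi (t + k)) x
  have e2 := setIntegral_measureReal_Ioi_sub μ (lsMeasure w) (Ioi t) (x - k)
  simp only [hT, Ioi_inter_Ioi] at e1 e2
  have hmeas : ∀ c d : ℝ, Integrable (fun y => μ.real (Ioi (c ⊔ (d - y)))) (lsMeasure w) := by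
    intro c d
    refine integrable_of_mem_Icc ?_ fun y => (memD_measureReal_Ioi μ).2.2.1 _
    exact (memD_measureReal_Ioi μ).1.measurable.comp
      (measurable_const.max (measurable_const.sub measurable_id))
  rw [e1, e2, ← integral_const_mul]
  refine integral_mono (hmeas _ _) ((hmeas _ _).const_mul _) fun y => ?_
  have : (t + k) ⊔ (x - y) = (t ⊔ (x - k - y)) + k := by
    rw [← max_add_add_right]; congr 1; ring
  simp only [this]
  exact htail _ _ (ht.trans (le_max_left _ _)) hk

/-- The properties of `Q(u) = 1 - ∑ₖ pₖ (1-u)^k` on `[0,1]` used in the proof of tightness. -/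
structure IsBranchingFunction (Q : ℝ → ℝ) (κ m c θ : ℝ) : Prop where
  continuousOn : ContinuousOn Q (Icc 0 1)
  monotoneOn : MonotoneOn Q (Icc 0 1)
  le_one : ∀ u ∈ Icc (0 : ℝ) 1, Q u ≤ 1
  lower : ∀ u ∈ Icc (0 : ℝ) 1, u + 2 * κ * (u * (1 - u)) ≤ Q u
  upper : ∀ u ∈ Icc (0 : ℝ) 1, Q u ≤ m * u
  expansion : ∀ u ∈ Icc (0 : ℝ) 1, m * u - c * u ^ θ ≤ Q u

lemma one_sub_pow_le_expansion {θ : ℝ} (hθ1 : 1 < θ) (hθ2 : θ ≤ 2) {u : ℝ}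
    (hu : u ∈ Icc (0 : ℝ) 1) (k : ℕ) :
    (1 - u) ^ k ≤ 1 - k * u + (k : ℝ) ^ θ * u ^ θ := by
  have hk : (0 : ℝ) ≤ k := k.cast_nonneg
  have hku : 0 ≤ k * u := mul_nonneg hk hu.1
  rw [← Real.mul_rpow hk hu.1]
  rcases le_total (k * u) 1 with h | h
  · have h1 : (1 - u) ^ k ≤ Real.exp (-(k * u)) := by
      have := Real.add_one_le_exp (-u)
      calc (1 - u) ^ k ≤ (Real.exp (-u)) ^ k :=
            pow_le_pow_left₀ (by linarith [hu.2]) (by linarith) k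
        _ = Real.exp (-(k * u)) := by rw [← Real.exp_nat_mul]; ring_nf
    have h2 : Real.exp (-(k * u)) ≤ 1 - k * u + (k * u) ^ 2 := by
      have := Real.abs_exp_sub_one_sub_id_le (x := -(k * u)) (by
        rw [abs_neg, abs_of_nonneg hku]; exact h)
      have := (abs_le.1 this).2
      linarith [neg_sq (k * u)]
    have h3 : (k * u) ^ 2 ≤ (k * u) ^ θ := by
      rw [← Real.rpow_natCast]
      exact Real.rpow_le_rpow_of_exponent_ge' hku h (by linarith) (by exact_mod_cast hθ2)
    linarith
  · have h1 : (1 - u) ^ k ≤ 1 := pow_le_one₀ (by linarith [hu.2]) (by linarith [hu.1])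
    have h2 : k * u ≤ (k * u) ^ θ := Real.self_le_rpow_of_one_le h hθ1.le
    linarith

lemma isBranchingFunction (p : ℕ → ℝ) (hp0 : ∀ k, 0 ≤ p k) (hp00 : p 0 = 0)
    (hpsum : ∑' k : ℕ, p k = 1)
    (θ : ℝ) (hθ1 : 1 < θ) (hθ2 : θ ≤ 2)
    (hmθ : Summable fun k : ℕ => (k : ℝ) ^ θ * p k) :
    ∃ m c : ℝ, 1 ≤ m ∧ 0 ≤ c ∧
      IsBranchingFunction (fun u => 1 - ∑' k : ℕ, p k * (1 - u) ^ k) ((1 - p 1) / 2) m c θ := by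
  have hs : Summable p := by
    by_contra h
    rw [tsum_eq_zero_of_not_summable h] at hpsum
    exact zero_ne_one hpsum
  have hkθ : ∀ k : ℕ, (k : ℝ) ≤ (k : ℝ) ^ θ := by
    intro k
    rcases Nat.eq_zero_or_pos k with rfl | hk
    · simp [Real.zero_rpow (by linarith : θ ≠ 0)]
    · exact Real.self_le_rpow_of_one_le (by exact_mod_cast hk) hθ1.le
  have hsm : Summable fun k : ℕ => (k : ℝ) * p k :=
    Summable.of_nonneg_of_le (fun k => mul_nonneg k.cast_nonneg (hp0 k))
      (fun k => mul_le_mul_of_nonneg_right (hkθ k) (hp0 k)) hmθ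
  have hpow : ∀ u ∈ Icc (0 : ℝ) 1, ∀ k : ℕ, 0 ≤ (1 - u) ^ k ∧ (1 - u) ^ k ≤ 1 := fun u hu k =>
    ⟨pow_nonneg (by linarith [hu.2]) k, pow_le_one₀ (by linarith [hu.2]) (by linarith [hu.1])⟩
  have hsu : ∀ u ∈ Icc (0 : ℝ) 1, Summable fun k : ℕ => p k * (1 - u) ^ k := fun u hu =>
    Summable.of_nonneg_of_le (fun k => mul_nonneg (hp0 k) (hpow u hu k).1)
      (fun k => mul_le_of_le_one_right (hp0 k) (hpow u hu k).2) hs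
  refine ⟨∑' k : ℕ, (k : ℝ) * p k, ∑' k : ℕ, (k : ℝ) ^ θ * p k, ?_, ?_, ?_, ?_, ?_, ?_, ?_, ?_⟩
  · rw [← hpsum]
    refine hs.tsum_le_tsum (fun k => ?_) hsm
    rcases Nat.eq_zero_or_pos k with rfl | hk
    · simp [hp00]
    · exact le_mul_of_one_le_left (hp0 k) (by exact_mod_cast hk)
  · exact tsum_nonneg fun k => mul_nonneg (Real.rpow_nonneg k.cast_nonneg _) (hp0 k)
  · refine continuousOn_const.sub (continuousOn_tsum (u := p) (fun k => ?_) hs fun k u hu => ?_)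
    · fun_prop
    · rw [Real.norm_eq_abs, abs_of_nonneg (mul_nonneg (hp0 k) (hpow u hu k).1)]
      exact mul_le_of_le_one_right (hp0 k) (hpow u hu k).2
  · intro u hu v hv huv
    refine sub_le_sub_left ((hsu v hv).tsum_le_tsum (fun k => ?_) (hsu u hu)) 1
    exact mul_le_mul_of_nonneg_left
      (pow_le_pow_left₀ (by linarith [hv.2]) (by linarith) k) (hp0 k)
  · intro u hu
    have : 0 ≤ ∑' k : ℕ, p k * (1 - u) ^ k :=
      tsum_nonneg fun k => mul_nonneg (hp0 k) (hpow u hu k).1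
    linarith
  · intro u hu
    have h0 : ∑' k : ℕ, (if k = 1 then p 1 * (u * (1 - u)) else 0) = p 1 * (u * (1 - u)) :=
      tsum_ite_eq 1 _
    have hs0 : Summable fun k : ℕ => if k = 1 then p 1 * (u * (1 - u)) else 0 :=
      (hasSum_ite_eq 1 _).summable
    have hs1 := (hs.mul_right ((1 - u) ^ 2)).add hs0
    have key : ∑' k : ℕ, p k * (1 - u) ^ k ≤
        ∑' k : ℕ, (p k * (1 - u) ^ 2 + if k = 1 then p 1 * (u * (1 - u)) else 0) := by
      refine (hsu u hu).tsum_le_tsum (fun k => ?_) hs1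
      rcases k with _ | _ | k
      · simp [hp00]
      · simp only [zero_add, if_true, pow_one]
        apply le_of_eq; ring
      · rw [if_neg (by omega), add_zero]
        exact mul_le_mul_of_nonneg_left
          (pow_le_pow_of_le_one (by linarith [hu.2]) (by linarith [hu.1]) (by omega)) (hp0 _)
    rw [(hs.mul_right ((1 - u) ^ 2)).tsum_add hs0, tsum_mul_right, hpsum, h0] at key
    linarith
  · intro u hu
    have key : ∑' k : ℕ, (p k - k * p k * u) ≤ ∑' k : ℕ, p k * (1 - u) ^ k := by
      refine (hs.sub (hsm.mul_right u)).tsum_le_tsum (fun k => ?_) (hsu u hu)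
      have := one_add_mul_le_pow (a := -u) (by linarith [hu.2]) k
      have := mul_le_mul_of_nonneg_left this (hp0 k)
      rw [← sub_eq_add_neg] at this
      linarith
    rw [hs.tsum_sub (hsm.mul_right u), tsum_mul_right, hpsum] at key
    linarith
  · intro u hu
    have hs2 := (hs.sub (hsm.mul_right u)).add (hmθ.mul_right (u ^ θ))
    have key : ∑' k : ℕ, p k * (1 - u) ^ k ≤
        ∑' k : ℕ, (p k - k * p k * u + (k : ℝ) ^ θ * p k * u ^ θ) := by
      refine (hsu u hu).tsum_le_tsum (fun k => ?_) hs2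
      have := mul_le_mul_of_nonneg_left (one_sub_pow_le_expansion hθ1 hθ2 hu k) (hp0 k)
      linarith
    rw [(hs.sub (hsm.mul_right u)).tsum_add (hmθ.mul_right (u ^ θ)),
      hs.tsum_sub (hsm.mul_right u), tsum_mul_right, tsum_mul_right, hpsum] at key
    linarith

namespace IsBranchingFunction

variable {Q : ℝ → ℝ} {κ m c θ : ℝ}

lemma self_le (hQ : IsBranchingFunction Q κ m c θ) (hκ : 0 ≤ κ) {u : ℝ}
    (hu : u ∈ Icc (0 : ℝ) 1) : u ≤ Q u := by
  have := hQ.lower u hu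
  have : 0 ≤ 2 * κ * (u * (1 - u)) :=
    mul_nonneg (by linarith) (mul_nonneg hu.1 (by linarith [hu.2]))
  linarith

lemma mem_Icc (hQ : IsBranchingFunction Q κ m c θ) (hκ : 0 ≤ κ) {u : ℝ}
    (hu : u ∈ Icc (0 : ℝ) 1) : Q u ∈ Icc (0 : ℝ) 1 :=
  ⟨hu.1.trans (hQ.self_le hκ hu), hQ.le_one u hu⟩

lemma memD_comp (hQ : IsBranchingFunction Q κ m c θ) (hκ : 0 ≤ κ) {u : ℝ → ℝ} (hu : MemD u) :
    MemD fun x => Q (u x) := by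
  obtain ⟨hanti, hcont, hI, hbot, htop⟩ := hu
  have h0 : Q 0 = 0 := le_antisymm (by simpa using hQ.upper 0 (by simp))
    (hQ.mem_Icc hκ (by simp)).1
  have h1 : Q 1 = 1 := le_antisymm (hQ.le_one 1 (by simp)) (hQ.self_le hκ (by simp))
  have hlim : ∀ l : Filter ℝ, ∀ b ∈ Icc (0 : ℝ) 1, Tendsto u l (nhds b) →
      Tendsto (fun x => Q (u x)) l (nhds (Q b)) := fun l b hb h =>
    (hQ.continuousOn b hb).tendsto.comp
      (tendsto_nhdsWithin_iff.2 ⟨h, Eventually.of_forall hI⟩)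
  refine ⟨fun x y hxy => hQ.monotoneOn (hI y) (hI x) (hanti hxy), fun x => hlim _ _ (hI x) (hcont x),
    fun x => hQ.mem_Icc hκ (hI x), ?_, ?_⟩
  · simpa [h1] using hlim _ 1 (by simp) hbot
  · simpa [h0] using hlim _ 0 (by simp) htop

end IsBranchingFunction

/-- Exponential decay of the tail of `μ` at rate `a` gives exponential moments of order `a / 2`. -/
lemma integrableOn_exp_half_mul {μ : Measure ℝ} [IsProbabilityMeasure μ] {a M₀ : ℝ} (ha : 0 < a)
    (hM₀ : 0 < M₀)
    (htail : ∀ x M : ℝ, 0 ≤ x → M₀ ≤ M →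
      μ.real (Ioi (x + M)) ≤ Real.exp (-(a * M)) * μ.real (Ioi x)) :
    IntegrableOn (fun t => Real.exp (a / 2 * t)) (Ioi 0) μ := by
  set b := a / 2 with hb
  have hb0 : 0 < b := by positivity
  have hprim : ∀ t : ℝ, ∫ s in (0 : ℝ)..t, b * Real.exp (b * s) = Real.exp (b * t) - 1 := by
    intro t
    have : ∀ s ∈ uIcc 0 t, HasDerivAt (fun s => Real.exp (b * s)) (b * Real.exp (b * s)) s := by
      intro s _
      have h1 : HasDerivAt (fun s => b * s) b s := by simpa using (hasDerivAt_id s).const_mul b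
      simpa [mul_comm] using h1.exp
    rw [intervalIntegral.integral_eq_sub_of_hasDerivAt this
      (Continuous.intervalIntegrable (by fun_prop) _ _)]
    simp
  have hlc := lintegral_comp_eq_lintegral_meas_lt_mul μ (f := fun t : ℝ => max t 0)
    (g := fun s => b * Real.exp (b * s)) (Eventually.of_forall fun t => le_max_right t 0)
    (by fun_prop) (fun t _ => Continuous.intervalIntegrable (by fun_prop) _ _)
    (Eventually.of_forall fun s => by positivity)
  simp only [hprim] at hlc
  have hbound : ∀ t : ℝ, 0 < t → μ.real (Ioi t) ≤ Real.exp (a * M₀) * Real.exp (-(a * t)) := by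
    intro t ht
    have h1 : ∀ y, μ.real (Ioi y) ≤ 1 := fun y => measureReal_le_one
    rw [← Real.exp_add]
    rcases le_total M₀ t with h | h
    · have h2 := htail 0 t le_rfl h
      rw [zero_add] at h2
      have h3 : Real.exp (-(a * t)) * μ.real (Ioi 0) ≤ Real.exp (-(a * t)) :=
        mul_le_of_le_one_right (Real.exp_pos _).le (h1 0)
      have : Real.exp (-(a * t)) ≤ Real.exp (a * M₀ + -(a * t)) :=
        Real.exp_le_exp.2 (by nlinarith)
      linarith
    · exact (h1 t).trans (Real.one_le_exp (by nlinarith))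
  have hfin : ∫⁻ t, ENNReal.ofReal (Real.exp (b * max t 0) - 1) ∂μ < ⊤ := by
    rw [hlc]
    have hi : IntegrableOn (fun t => Real.exp (a * M₀) * b * Real.exp (-b * t)) (Ioi 0) :=
      (exp_neg_integrableOn_Ioi 0 hb0).const_mul _
    refine lt_of_le_of_lt (setLIntegral_mono' measurableSet_Ioi fun t ht => ?_)
      hi.lintegral_lt_top
    have hset : {x : ℝ | t < max x 0} = Ioi t := by
      ext x
      simp [not_lt.2 (le_of_lt (mem_Ioi.1 ht))]
    rw [hset, ← ofReal_measureReal, ← ENNReal.ofReal_mul measureReal_nonneg]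
    refine ENNReal.ofReal_le_ofReal ?_
    calc μ.real (Ioi t) * (b * Real.exp (b * t))
        ≤ Real.exp (a * M₀) * Real.exp (-(a * t)) * (b * Real.exp (b * t)) :=
          mul_le_mul_of_nonneg_right (hbound t ht) (by positivity)
      _ = Real.exp (a * M₀) * b * (Real.exp (-(a * t)) * Real.exp (b * t)) := by ring
      _ = Real.exp (a * M₀) * b * Real.exp (-b * t) := by
          rw [← Real.exp_add]; congr 2; rw [hb]; ring
  have hint : Integrable (fun t => Real.exp (b * max t 0) - 1) μ := by
    refine ⟨by fun_prop, ?_⟩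
    rw [hasFiniteIntegral_iff_ofReal]
    · exact hfin
    · refine Eventually.of_forall fun t => ?_
      have : 1 ≤ Real.exp (b * max t 0) :=
        Real.one_le_exp (mul_nonneg hb0.le (le_max_right _ _))
      simpa using this
  refine ((hint.add (integrable_const 1)).integrableOn (s := Ioi 0)).congr_fun
    (fun t ht => ?_) measurableSet_Ioi
  simp [max_eq_left (le_of_lt (mem_Ioi.1 ht))]

/-- The parts of an integral carried by `(T, ∞)` tend to zero as `T → ∞`. -/
lemma tendsto_setIntegral_Ioi_atTop {μ : Measure ℝ} {f : ℝ → ℝ} (hf : IntegrableOn f (Ioi 0) μ) :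
    Tendsto (fun T : ℝ => ∫ t in Ioi T, f t ∂μ) atTop (nhds 0) := by
  have h := tendsto_setIntegral_of_antitone (μ := μ) (f := f) (s := fun T : ℝ => Ioi T)
    (fun _ => measurableSet_Ioi) (fun _ _ h => Ioi_subset_Ioi h) ⟨0, hf⟩
  have hempty : ⋂ T : ℝ, Ioi T = ∅ := by
    ext x
    simp only [mem_iInter, mem_Ioi, mem_empty_iff_false, iff_false, not_forall, not_lt]
    exact ⟨x, le_rfl⟩
  simpa [hempty] using h

/-- `u` grows by a factor of nearly `1 + ε` over every interval of length `M`, with an error that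
disappears where `u` is small. -/
def Nonflat (ε D s M : ℝ) (u : ℝ → ℝ) : Prop :=
  ∀ x, (1 + ε - D * u x ^ s) * u x ≤ u (x - M)

lemma IsBranchingFunction.nonflat_comp {Q : ℝ → ℝ} {κ m c θ : ℝ}
    (hQ : IsBranchingFunction Q κ m c θ) (hκ : 0 ≤ κ) (hm : 1 ≤ m) (hc : 0 ≤ c) (hθ1 : 1 < θ)
    (hθ2 : θ ≤ 2) {ε D M : ℝ} (hε0 : 0 ≤ ε) (hε1 : ε ≤ 1) (hD : 0 ≤ D) (hM : 0 ≤ M) {v : ℝ → ℝ}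
    (hv : MemD v) (hflat : Nonflat ε D (θ - 1) M v) (y : ℝ) :
    (1 + ε - (D + 4 * c) * v y ^ (θ - 1)) * Q (v y) ≤ Q (v (y - M)) := by
  have hB := hv.2.2.1 y
  have hA := hv.2.2.1 (y - M)
  have hBA : v y ≤ v (y - M) := hv.1 (by linarith)
  have hP := hflat y
  set A := v (y - M)
  set B := v y
  have hBs : 0 ≤ B ^ (θ - 1) := Real.rpow_nonneg hB.1 _
  have hQB := hQ.mem_Icc hκ hB
  rcases le_or_gt (1 + ε - (D + 4 * c) * B ^ (θ - 1)) 1 with h | h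
  · exact (mul_le_of_le_one_left hQB.1 h).trans (hQ.monotoneOn hB hA hBA)
  · have hA'I : min A ((1 + ε) * B) ∈ Icc (0 : ℝ) 1 :=
      ⟨le_min hA.1 (mul_nonneg (by linarith) hB.1), (min_le_left _ _).trans hA.2⟩
    have hA'low : (1 + ε - D * B ^ (θ - 1)) * B ≤ min A ((1 + ε) * B) :=
      le_min hP (mul_le_mul_of_nonneg_right (by nlinarith [mul_nonneg hD hBs]) hB.1)
    have hA'up : min A ((1 + ε) * B) ≤ 2 * B :=
      (min_le_right _ _).trans (mul_le_mul_of_nonneg_right (by linarith) hB.1)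
    have hQA' := hQ.monotoneOn hA'I hA (min_le_left _ _)
    have hexp := hQ.expansion _ hA'I
    have hpow : (min A ((1 + ε) * B)) ^ θ ≤ 4 * (B ^ (θ - 1) * B) := by
      calc (min A ((1 + ε) * B)) ^ θ ≤ (2 * B) ^ θ :=
            Real.rpow_le_rpow hA'I.1 hA'up (by linarith)
        _ = 2 ^ θ * B ^ θ := Real.mul_rpow (by norm_num) hB.1
        _ ≤ 4 * (B ^ (θ - 1) * B) := by
            have h2 : (2 : ℝ) ^ θ ≤ 4 := by
              calc (2 : ℝ) ^ θ ≤ 2 ^ (2 : ℝ) := Real.rpow_le_rpow_of_exponent_le (by norm_num) hθ2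
                _ = 4 := by norm_num
            have h3 : B ^ θ = B ^ (θ - 1) * B := by
              conv_lhs => rw [show θ = (θ - 1) + 1 by ring]
              rw [Real.rpow_add_of_nonneg hB.1 (by linarith) (by norm_num), Real.rpow_one]
            rw [h3]
            exact mul_le_mul_of_nonneg_right h2 (mul_nonneg hBs hB.1)
    generalize min A ((1 + ε) * B) = A' at *
    have hup := hQ.upper B hB
    have e1 : m * ((1 + ε - D * B ^ (θ - 1)) * B) ≤ m * A' :=
      mul_le_mul_of_nonneg_left hA'low (by linarith)
    have e2 : c * A' ^ θ ≤ c * (4 * (B ^ (θ - 1) * B)) := mul_le_mul_of_nonneg_left hpow hc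
    have e3 : c * (B ^ (θ - 1) * B) ≤ m * (c * (B ^ (θ - 1) * B)) :=
      le_mul_of_one_le_left (mul_nonneg hc (mul_nonneg hBs hB.1)) hm
    have e4 := mul_le_mul_of_nonneg_left hup (by linarith : 0 ≤ 1 + ε - (D + 4 * c) * B ^ (θ - 1))
    nlinarith

/-- Either `w` grows at most exponentially to the left of `x`, or the region to the left of the
last excess contributes a gain in the convolution. -/
lemma MemD.exists_barrier_set {w : ℝ → ℝ} (hw : MemD w) {μ : Measure ℝ}
    [IsProbabilityMeasure μ] {a M₀ : ℝ} (ha : 0 < a)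
    (htail : ∀ x M : ℝ, 0 ≤ x → M₀ ≤ M →
      μ.real (Ioi (x + M)) ≤ Real.exp (-(a * M)) * μ.real (Ioi x))
    {M C ε K x : ℝ} (hε0 : 0 ≤ ε) (hε1 : ε ≤ 1) (hM4 : 4 ≤ M) (hMM₀ : 4 * M₀ ≤ M)
    (hMC : 2 * C ≤ M) (hMexp : 4 ≤ Real.exp (a * M / 16)) (hK : 0 ≤ K)
    (hbar : ∀ y, x - M + C ≤ y → w y ≤ K) :
    ∃ S : Set ℝ, MeasurableSet S ∧
      (∀ t ∈ S, 0 ≤ t → w (x - t) ≤ K * Real.exp (a / 4 * t)) ∧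
      ∫ t in Sᶜ, ((1 + ε) * w (x - t) - w (x - M - t)) ∂μ ≤ 0 := by
  set B : Set ℝ := {L | 0 ≤ L ∧ K * Real.exp (a / 4 * L) < w (x - L)} with hBdef
  rcases B.eq_empty_or_nonempty with hB | hB
  · refine ⟨univ, MeasurableSet.univ, fun t _ ht => ?_, by simp⟩
    by_contra h
    have : t ∈ B := ⟨ht, not_le.1 h⟩
    simp [hB] at this
  · have hbdd : BddBelow B := ⟨0, fun L hL => hL.1⟩
    obtain ⟨L, hLB, hL⟩ := exists_lt_of_csInf_lt hB (lt_add_one (sInf B))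
    have hbelow : ∀ t, 0 ≤ t → t ≤ L - 1 → w (x - t) ≤ K * Real.exp (a / 4 * t) := by
      intro t ht htL
      by_contra h
      have : sInf B ≤ t := csInf_le hbdd ⟨ht, not_le.1 h⟩
      linarith
    have hwL : K * Real.exp (a / 4 * L) < w (x - L) := hLB.2
    have hLM : M - C < L := by
      by_contra h
      have h1 := hbar (x - L) (by linarith [not_lt.1 h])
      have h2 : K ≤ K * Real.exp (a / 4 * L) :=
        le_mul_of_one_le_right hK (Real.one_le_exp (by have := hLB.1; positivity))
      linarith
    refine ⟨Iic (L - M / 2), measurableSet_Iic, fun t ht ht0 => hbelow t ht0 ?_, ?_⟩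
    · linarith [mem_Iic.1 ht]
    set t₀ := L - M / 2 with ht₀
    have ht₀0 : 0 ≤ t₀ := by linarith
    have hint : ∀ z (S : Set ℝ), IntegrableOn (fun t => w (z - t)) S μ := fun z S =>
      (hw.integrable_comp_sub μ z).integrableOn
    rw [compl_Iic, integral_sub ((hint x _).const_mul _) (hint (x - M) _), integral_const_mul]
    have hsplit : ∫ t in Ioi t₀, w (x - t) ∂μ =
        ∫ t in Ioc t₀ (t₀ + M / 4), w (x - t) ∂μ + ∫ t in Ioi (t₀ + M / 4), w (x - t) ∂μ := by
      rw [← setIntegral_union (Ioc_disjoint_Ioi le_rfl) measurableSet_Ioi (hint _ _) (hint _ _),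
        Ioc_union_Ioi_eq_Ioi (by linarith)]
    have hlower : w (x - L) * μ.real (Ioi t₀) ≤ ∫ t in Ioi t₀, w (x - M - t) ∂μ := by
      rw [mul_comm, ← smul_eq_mul, ← setIntegral_const]
      refine setIntegral_mono_on (integrable_const _).integrableOn (hint _ _) measurableSet_Ioi
        fun t ht => hw.1 ?_
      have := mem_Ioi.1 ht
      linarith
    have hwin : w (x - (L - M / 4)) ≤ w (x - L) / 4 := by
      have h1 := hbelow (L - M / 4) (by linarith) (by linarith)
      have h2 : Real.exp (a / 4 * (L - M / 4)) * Real.exp (a * M / 16) = Real.exp (a / 4 * L) := by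
        rw [← Real.exp_add]; congr 1; ring
      have h3 : K * Real.exp (a / 4 * (L - M / 4)) * 4 ≤ K * Real.exp (a / 4 * L) := by
        rw [← h2, ← mul_assoc]
        exact mul_le_mul_of_nonneg_left hMexp (by positivity)
      linarith
    have hfirst : ∫ t in Ioc t₀ (t₀ + M / 4), w (x - t) ∂μ ≤ w (x - L) / 4 * μ.real (Ioi t₀) := by
      have h1 : ∫ t in Ioc t₀ (t₀ + M / 4), w (x - t) ∂μ ≤
          ∫ _t in Ioc t₀ (t₀ + M / 4), w (x - L) / 4 ∂μ := by
        refine setIntegral_mono_on (hint _ _) (integrable_const _).integrableOn measurableSet_Ioc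
          fun t ht => le_trans (hw.1 ?_) hwin
        have := ht.2
        linarith
      rw [setIntegral_const, smul_eq_mul, mul_comm] at h1
      refine h1.trans (mul_le_mul_of_nonneg_left
        (measureReal_mono Ioc_subset_Ioi_self) ?_)
      linarith [(hw.2.2.1 (x - L)).1]
    have hsecond := hw.setIntegral_Ioi_add_le htail ht₀0 (by linarith : M₀ ≤ M / 4) x
    have hmono : ∫ t in Ioi t₀, w (x - M / 4 - t) ∂μ ≤ ∫ t in Ioi t₀, w (x - M - t) ∂μ :=
      setIntegral_mono_on (hint _ _) (hint _ _) measurableSet_Ioi fun t _ => hw.1 (by linarith)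
    have hI' : 0 ≤ ∫ t in Ioi t₀, w (x - M - t) ∂μ :=
      setIntegral_nonneg measurableSet_Ioi fun t _ => (hw.2.2.1 _).1
    have hexp : Real.exp (-(a * (M / 4))) ≤ 1 / 4 := by
      rw [Real.exp_neg, ← one_div]
      refine one_div_le_one_div_of_le (by norm_num) (hMexp.trans (Real.exp_le_exp.2 ?_))
      nlinarith
    have hI4 : ∫ t in Ioi (t₀ + M / 4), w (x - t) ∂μ ≤
        1 / 4 * ∫ t in Ioi t₀, w (x - M - t) ∂μ :=
      hsecond.trans ((mul_le_mul_of_nonneg_left hmono (Real.exp_pos _).le).trans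
        (mul_le_mul_of_nonneg_right hexp hI'))
    have hhalf : ∫ t in Ioi t₀, w (x - t) ∂μ ≤ 1 / 2 * ∫ t in Ioi t₀, w (x - M - t) ∂μ := by
      rw [hsplit]; linarith
    have hI0 : 0 ≤ ∫ t in Ioi t₀, w (x - t) ∂μ :=
      setIntegral_nonneg measurableSet_Ioi fun t _ => (hw.2.2.1 _).1
    nlinarith

set_option maxHeartbeats 1000000 in
/-- One step of the recursion preserves nonflatness, for suitable constants. -/
lemma IsBranchingFunction.nonflat_step {Q : ℝ → ℝ} {κ m c θ : ℝ}
    (hQ : IsBranchingFunction Q κ m c θ) (hκ : 0 < κ) (hm : 1 ≤ m) (hc : 0 ≤ c) (hθ1 : 1 < θ)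
    (hθ2 : θ ≤ 2) {μ : Measure ℝ} [IsProbabilityMeasure μ] {a M₀ : ℝ} (ha : 0 < a)
    (hM₀ : 0 < M₀)
    (htail : ∀ x M : ℝ, 0 ≤ x → M₀ ≤ M →
      μ.real (Ioi (x + M)) ≤ Real.exp (-(a * M)) * μ.real (Ioi x))
    {M C ε D r q : ℝ} (hε0 : 0 < ε) (hε1 : ε ≤ 1) (hM4 : 4 ≤ M) (hMM₀ : 4 * M₀ ≤ M)
    (hMC : 2 * C ≤ M) (hMexp : 4 ≤ Real.exp (a * M / 16))
    (hMint : m ^ 2 * ∫ t in Ioi (M - C), Real.exp (a / 2 * t) ∂μ ≤ (1 - r ^ (θ - 1)) / 2)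
    (hr0 : 0 < r) (hr1 : r < 1) (hq : q ≤ μ.real (Ioi (-C))) (hq2 : 1 / 2 ≤ q)
    (hrq : 1 + ε ≤ r * (q * (1 + κ))) (hDε : 8 * ε ≤ D)
    (hDc : (D + 4 * c) * ((1 + r ^ (θ - 1)) / 2) ≤ D)
    {v : ℝ → ℝ} (hv : MemD v) (hflat : Nonflat ε D (θ - 1) M v) :
    Nonflat ε D (θ - 1) M fun x => ∫ t, Q (v (x - t)) ∂μ := by
  have hw : MemD fun x => Q (v x) := hQ.memD_comp hκ.le hv
  have hu := (hw.convolution μ).2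
  have hint := fun z => hw.integrable_comp_sub μ z
  have hD : 0 ≤ D := by linarith
  have hs0 : 0 < θ - 1 := by linarith
  intro x
  have hUI := hu.2.2.1 x
  have huM : (∫ t, Q (v (x - t)) ∂μ) ≤ ∫ t, Q (v (x - M - t)) ∂μ := hu.1 (by linarith)
  show (1 + ε - D * (∫ t, Q (v (x - t)) ∂μ) ^ (θ - 1)) * (∫ t, Q (v (x - t)) ∂μ) ≤
    ∫ t, Q (v (x - M - t)) ∂μ
  set U := ∫ t, Q (v (x - t)) ∂μ with hU
  set V := ∫ t, Q (v (x - M - t)) ∂μ with hV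
  change 0 ≤ U ∧ U ≤ 1 at hUI
  have hU0 := hUI.1
  have hUs : 0 ≤ U ^ (θ - 1) := Real.rpow_nonneg hU0 _
  have hDU := mul_nonneg hD hUs
  rcases le_or_gt ((1 + ε) * U) V with hfl | hfl
  · nlinarith
  rcases le_or_gt ε (D * U ^ (θ - 1)) with hsm | hsm
  · nlinarith
  -- the value of `v` just to the right of `x - M`
  have hVlow : q * Q (v (x - M + C)) ≤ V := by
    have h1 : ∫ t in Ioi (-C), Q (v (x - M - t)) ∂μ ≤ V :=
      setIntegral_le_integral (hint _) (Eventually.of_forall fun t => (hw.2.2.1 _).1)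
    have h2 : ∫ _t in Ioi (-C), Q (v (x - M + C)) ∂μ ≤ ∫ t in Ioi (-C), Q (v (x - M - t)) ∂μ :=
      setIntegral_mono_on (integrable_const _).integrableOn (hint _).integrableOn measurableSet_Ioi
        fun t ht => hw.1 (by linarith [mem_Ioi.1 ht])
    rw [setIntegral_const, smul_eq_mul] at h2
    exact (mul_le_mul_of_nonneg_right hq (hw.2.2.1 _).1).trans (h2.trans h1)
  have hv0 := hv.2.2.1 (x - M + C)
  have hhalf : v (x - M + C) ≤ 1 / 2 := by
    by_contra hcon
    have hcon := not_le.1 hcon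
    have h1 := hQ.self_le hκ.le hv0
    have h2 : 1 / 8 ≤ U := by nlinarith
    have h3 : (1 / 8 : ℝ) ≤ U ^ (θ - 1) := by
      have h4 : U ^ (1 : ℝ) ≤ U ^ (θ - 1) :=
        Real.rpow_le_rpow_of_exponent_ge' hU0 hUI.2 hs0.le (by linarith)
      rw [Real.rpow_one] at h4
      exact h2.trans h4
    nlinarith
  have hvr : v (x - M + C) ≤ r * U := by
    have h1 : (1 + κ) * v (x - M + C) ≤ Q (v (x - M + C)) := by
      have := hQ.lower _ hv0
      have : v (x - M + C) * (1 / 2) ≤ v (x - M + C) * (1 - v (x - M + C)) :=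
        mul_le_mul_of_nonneg_left (by linarith) hv0.1
      nlinarith
    have h2 : q * (1 + κ) * v (x - M + C) ≤ (1 + ε) * U := by
      have := mul_le_mul_of_nonneg_left h1 (by linarith : 0 ≤ q)
      linarith
    have h3 : (1 + ε) * U ≤ r * (q * (1 + κ)) * U := mul_le_mul_of_nonneg_right hrq hU0
    have h4 : 0 < q * (1 + κ) := by positivity
    refine le_of_mul_le_mul_left ?_ h4
    linarith
  have hbar : ∀ y, x - M + C ≤ y → Q (v y) ≤ m * U := by
    intro y hy
    have h1 : v y ≤ r * U := (hv.1 hy).trans hvr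
    have h2 : r * U ≤ U := mul_le_of_le_one_left hU0 hr1.le
    exact (hQ.upper _ (hv.2.2.1 y)).trans
      (mul_le_mul_of_nonneg_left (h1.trans h2) (by linarith))
  have hK : 0 ≤ m * U := by positivity
  obtain ⟨S, hS, hSbar, hSgain⟩ :=
    hw.exists_barrier_set ha htail hε0.le hε1 hM4 hMM₀ hMC hMexp hK hbar
  have hdiff : Integrable (fun t => (1 + ε) * Q (v (x - t)) - Q (v (x - M - t))) μ :=
    ((hint x).const_mul _).sub (hint (x - M))
  have hUV : (1 + ε) * U - V ≤ ∫ t in S, ((1 + ε) * Q (v (x - t)) - Q (v (x - M - t))) ∂μ := by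
    have h1 : (1 + ε) * U - V = ∫ t, ((1 + ε) * Q (v (x - t)) - Q (v (x - M - t))) ∂μ := by
      rw [integral_sub ((hint x).const_mul _) (hint (x - M)), integral_const_mul]
    rw [h1, ← integral_add_compl hS hdiff]
    linarith
  have hexp : IntegrableOn (fun t => Real.exp (a / 2 * t)) (Ioi (M - C)) μ :=
    (integrableOn_exp_half_mul ha hM₀ htail).mono_set (Ioi_subset_Ioi (by linarith))
  have hrU : r ^ (θ - 1) * U ^ (θ - 1) = (r * U) ^ (θ - 1) := (Real.mul_rpow hr0.le hU0).symm
  set φ : ℝ → ℝ := fun t => (r * U) ^ (θ - 1) * Q (v (x - t)) +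
    (m * U) ^ θ * (Ioi (M - C)).indicator (fun t => Real.exp (a / 2 * t)) t with hφ
  have hφint : Integrable φ μ :=
    ((hint x).const_mul _).add ((hexp.integrable_indicator measurableSet_Ioi).const_mul _)
  have hmUθ : 0 ≤ (m * U) ^ θ := Real.rpow_nonneg hK _
  have hrUs : 0 ≤ (r * U) ^ (θ - 1) := Real.rpow_nonneg (by positivity) _
  have hφ0 : ∀ t, 0 ≤ φ t := fun t => by
    refine add_nonneg (mul_nonneg hrUs (hw.2.2.1 _).1) (mul_nonneg hmUθ ?_)
    exact indicator_nonneg (fun t _ => (Real.exp_pos _).le) t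
  have hpt : ∀ t ∈ S, (1 + ε) * Q (v (x - t)) - Q (v (x - M - t)) ≤ (D + 4 * c) * φ t := by
    intro t ht
    have h1 := hQ.nonflat_comp hκ.le hm hc hθ1 hθ2 hε0.le hε1 hD (by linarith) hv hflat (x - t)
    rw [show x - t - M = x - M - t by ring] at h1
    have hw0 := hw.2.2.1 (x - t)
    have hvI := hv.2.2.1 (x - t)
    have h2 : v (x - t) ^ (θ - 1) * Q (v (x - t)) ≤ φ t := by
      rcases le_or_gt t (M - C) with htM | htM
      · have h3 : v (x - t) ≤ r * U := (hv.1 (by linarith)).trans hvr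
        have h4 : v (x - t) ^ (θ - 1) ≤ (r * U) ^ (θ - 1) :=
          Real.rpow_le_rpow hvI.1 h3 hs0.le
        have h5 : 0 ≤ (Ioi (M - C)).indicator (fun t => Real.exp (a / 2 * t)) t :=
          indicator_nonneg (fun t _ => (Real.exp_pos _).le) t
        have := mul_le_mul_of_nonneg_right h4 hw0.1
        have := mul_nonneg hmUθ h5
        simp only [hφ]
        linarith
      · have ht0 : 0 ≤ t := by linarith
        have h3 : v (x - t) ^ (θ - 1) ≤ Q (v (x - t)) ^ (θ - 1) :=
          Real.rpow_le_rpow hvI.1 (hQ.self_le hκ.le hvI) hs0.le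
        have h4 : Q (v (x - t)) ^ (θ - 1) * Q (v (x - t)) = Q (v (x - t)) ^ θ := by
          conv_rhs => rw [show θ = (θ - 1) + 1 by ring]
          rw [Real.rpow_add_of_nonneg hw0.1 (by linarith) (by norm_num), Real.rpow_one]
        have h5 : Q (v (x - t)) ^ θ ≤ (m * U) ^ θ * Real.exp (a / 2 * t) := by
          calc Q (v (x - t)) ^ θ ≤ (m * U * Real.exp (a / 4 * t)) ^ θ :=
                Real.rpow_le_rpow hw0.1 (hSbar t ht ht0) (by linarith)
            _ = (m * U) ^ θ * Real.exp (a / 4 * t * θ) := by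
                rw [Real.mul_rpow hK (Real.exp_pos _).le, ← Real.exp_mul]
            _ ≤ (m * U) ^ θ * Real.exp (a / 2 * t) := by
                refine mul_le_mul_of_nonneg_left (Real.exp_le_exp.2 ?_) hmUθ
                have : 0 ≤ a * t := by positivity
                nlinarith
        have h6 := mul_le_mul_of_nonneg_right h3 hw0.1
        have h7 := mul_nonneg hrUs hw0.1
        simp only [hφ, indicator_of_mem (mem_Ioi.2 htM)]
        linarith
    have := mul_le_mul_of_nonneg_left h2 (by linarith : 0 ≤ D + 4 * c)
    linarith
  have hφtot : ∫ t, φ t ∂μ ≤ (1 + r ^ (θ - 1)) / 2 * (U ^ (θ - 1) * U) := by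
    have h1 : ∫ t, φ t ∂μ = (r * U) ^ (θ - 1) * U +
        (m * U) ^ θ * ∫ t in Ioi (M - C), Real.exp (a / 2 * t) ∂μ := by
      rw [hφ, integral_add ((hint x).const_mul _)
        ((hexp.integrable_indicator measurableSet_Ioi).const_mul _), integral_const_mul,
        integral_const_mul, integral_indicator measurableSet_Ioi]
    have hJ : 0 ≤ ∫ t in Ioi (M - C), Real.exp (a / 2 * t) ∂μ :=
      setIntegral_nonneg measurableSet_Ioi fun t _ => (Real.exp_pos _).le
    have h2 : (m * U) ^ θ ≤ m ^ 2 * (U ^ (θ - 1) * U) := by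
      rw [Real.mul_rpow (by linarith) hU0]
      have h3 : U ^ θ = U ^ (θ - 1) * U := by
        conv_lhs => rw [show θ = (θ - 1) + 1 by ring]
        rw [Real.rpow_add_of_nonneg hU0 (by linarith) (by norm_num), Real.rpow_one]
      rw [h3]
      refine mul_le_mul_of_nonneg_right ?_ (mul_nonneg hUs hU0)
      rw [← Real.rpow_natCast]
      exact Real.rpow_le_rpow_of_exponent_le hm (by exact_mod_cast hθ2)
    have h4 := mul_le_mul_of_nonneg_right h2 hJ
    have h5 := mul_le_mul_of_nonneg_right hMint (mul_nonneg hUs hU0)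
    rw [h1, ← hrU]
    linarith
  have hfinal : (1 + ε) * U - V ≤ D * (U ^ (θ - 1) * U) := by
    calc (1 + ε) * U - V ≤ ∫ t in S, (D + 4 * c) * φ t ∂μ :=
          hUV.trans (setIntegral_mono_on hdiff.integrableOn (hφint.const_mul _).integrableOn hS hpt)
      _ ≤ ∫ t, (D + 4 * c) * φ t ∂μ := setIntegral_le_integral (hφint.const_mul _)
          (Eventually.of_forall fun t => mul_nonneg (by linarith) (hφ0 t))
      _ = (D + 4 * c) * ∫ t, φ t ∂μ := integral_const_mul _ _
      _ ≤ (D + 4 * c) * ((1 + r ^ (θ - 1)) / 2 * (U ^ (θ - 1) * U)) :=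
          mul_le_mul_of_nonneg_left hφtot (by linarith)
      _ ≤ D * (U ^ (θ - 1) * U) := by
          rw [← mul_assoc]
          exact mul_le_mul_of_nonneg_right hDc (mul_nonneg hUs hU0)
  linarith

lemma IsBranchingFunction.exists_nonflat_step {Q : ℝ → ℝ} {κ m c θ : ℝ}
    (hQ : IsBranchingFunction Q κ m c θ) (hκ : 0 < κ) (hκ1 : κ ≤ 1) (hm : 1 ≤ m) (hc : 0 ≤ c)
    (hθ1 : 1 < θ) (hθ2 : θ ≤ 2) {μ : Measure ℝ} [IsProbabilityMeasure μ] {a M₀ : ℝ} (ha : 0 < a)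
    (hM₀ : 0 < M₀)
    (htail : ∀ x M : ℝ, 0 ≤ x → M₀ ≤ M →
      μ.real (Ioi (x + M)) ≤ Real.exp (-(a * M)) * μ.real (Ioi x)) :
    ∃ ε D M : ℝ, 0 < ε ∧ ε ≤ D ∧ 0 < M ∧ ∀ v, MemD v → Nonflat ε D (θ - 1) M v →
      Nonflat ε D (θ - 1) M fun x => ∫ t, Q (v (x - t)) ∂μ := by
  set q : ℝ := (1 + κ / 4) / (1 + κ / 2) with hq
  set r : ℝ := (1 + κ / 2) / (1 + κ) with hr
  have hq1 : q < 1 := by rw [hq, div_lt_one (by positivity)]; linarith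
  have hq2 : 1 / 2 ≤ q := by rw [hq, le_div_iff₀ (by positivity)]; linarith
  have hr0 : 0 < r := by positivity
  have hr1 : r < 1 := by rw [hr, div_lt_one (by positivity)]; linarith
  have hrq : 1 + κ / 4 ≤ r * (q * (1 + κ)) := by
    rw [hr, hq]; apply le_of_eq; field_simp
  have hσ : r ^ (θ - 1) < 1 := Real.rpow_lt_one hr0.le hr1 (by linarith)
  have hσ0 : 0 < r ^ (θ - 1) := Real.rpow_pos_of_pos hr0 _
  set σ := r ^ (θ - 1) with hσdef
  obtain ⟨C', hC'⟩ := ((memD_measureReal_Ioi μ).2.2.2.1.eventually (eventually_gt_nhds hq1)).exists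
  have hJ : Tendsto (fun M => m ^ 2 * ∫ t in Ioi (M - -C'), Real.exp (a / 2 * t) ∂μ) atTop
      (nhds 0) := by
    have h1 := (tendsto_setIntegral_Ioi_atTop (integrableOn_exp_half_mul ha hM₀ htail)).comp
      (tendsto_atTop_add_const_right atTop C' tendsto_id)
    simpa [Function.comp_def] using h1.const_mul (m ^ 2)
  have hE : Tendsto (fun M => Real.exp (a * M / 16)) atTop atTop :=
    Real.tendsto_exp_atTop.comp ((tendsto_id.const_mul_atTop ha).atTop_div_const (by norm_num))
  obtain ⟨M, hM1, hM2, hM3, hM4, hM5⟩ := ((hJ.eventually (eventually_lt_nhds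
    (by linarith : 0 < (1 - σ) / 2))).and ((hE.eventually_ge_atTop 4).and
    ((eventually_ge_atTop 4).and ((eventually_ge_atTop (4 * M₀)).and
    (eventually_ge_atTop (2 * -C')))))).exists
  have hfrac : 0 ≤ 4 * c * (1 + σ) / (1 - σ) :=
    div_nonneg (by positivity) (by linarith)
  refine ⟨κ / 4, 8 * (κ / 4) + 4 * c * (1 + σ) / (1 - σ), M, by positivity, by linarith,
    by linarith, fun v hv hflat => ?_⟩
  refine hQ.nonflat_step (r := r) (q := q) (C := -C') hκ hm hc hθ1 hθ2 ha hM₀ htail (by positivity)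
    (by linarith) hM3 hM4 hM5 hM2 hM1.le hr0 hr1 (by simpa using hC'.le) hq2 hrq (by linarith) ?_
    hv hflat
  rw [← hσdef]
  have h1 : 4 * c * (1 + σ) / (1 - σ) * (1 - σ) = 4 * c * (1 + σ) :=
    div_mul_cancel₀ _ (by linarith)
  generalize 4 * c * (1 + σ) / (1 - σ) = z at *
  nlinarith [mul_pos hκ (by linarith : 0 < 1 - σ)]

/-- A nonflat function grows from any small value to a fixed one over a bounded interval. -/
lemma Nonflat.exists_shift {ε D s M : ℝ} (hε : 0 < ε) (hD : 0 < D) (hs : 0 < s) (hM : 0 < M) :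
    ∃ δ₀ : ℝ, 0 < δ₀ ∧ δ₀ ≤ 1 / 2 ∧ ∀ δ : ℝ, 0 < δ → ∃ B : ℝ, ∀ u, MemD u → Nonflat ε D s M u →
      ∀ x, δ < u x → δ₀ < u (x - B) := by
  have hlim : Tendsto (fun t : ℝ => D * t ^ s) (nhds 0) (nhds 0) := by
    have := (Real.continuousAt_rpow_const 0 s (Or.inr hs.le)).tendsto.const_mul D
    simpa [Real.zero_rpow hs.ne'] using this
  obtain ⟨e, he, hball⟩ := Metric.eventually_nhds_iff.1
    (hlim.eventually (eventually_lt_nhds (half_pos hε)))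
  have hδ₀ : 0 < min (e / 2) (1 / 2) := by positivity
  refine ⟨min (e / 2) (1 / 2), hδ₀, min_le_right _ _, fun δ hδ => ?_⟩
  have hsmall : D * (min (e / 2) (1 / 2)) ^ s < ε / 2 := by
    refine hball ?_
    rw [Real.dist_eq, sub_zero, abs_of_pos hδ₀]
    exact (min_le_left _ _).trans_lt (by linarith)
  generalize min (e / 2) (1 / 2) = δ₀ at *
  obtain ⟨J, hJ⟩ := pow_unbounded_of_one_lt (δ₀ / δ) (by linarith : 1 < 1 + ε / 2)
  rw [div_lt_iff₀ hδ] at hJ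
  refine ⟨J * M, fun u hu hflat x hx => ?_⟩
  by_contra hcon
  have hcon := not_lt.1 hcon
  have key : ∀ j : ℕ, j ≤ J → (1 + ε / 2) ^ j * u x ≤ u (x - j * M) := by
    intro j
    induction j with
    | zero => simp
    | succ j ih =>
      intro hj
      have h1 := ih (by omega)
      have hjJ : (j : ℝ) ≤ J := by exact_mod_cast (by omega : j ≤ J)
      have h2 : u (x - j * M) ≤ δ₀ := (hu.1 (by nlinarith)).trans hcon
      have hI := hu.2.2.1 (x - j * M)
      have h3 := hflat (x - j * M)
      have h4 : D * u (x - j * M) ^ s ≤ D * δ₀ ^ s :=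
        mul_le_mul_of_nonneg_left (Real.rpow_le_rpow hI.1 h2 hs.le) hD.le
      have h5 : (1 + ε / 2) * u (x - j * M) ≤ u (x - j * M - M) :=
        (mul_le_mul_of_nonneg_right (by linarith) hI.1).trans h3
      have h6 := mul_le_mul_of_nonneg_left h1 (by linarith : 0 ≤ 1 + ε / 2)
      calc (1 + ε / 2) ^ (j + 1) * u x = (1 + ε / 2) * ((1 + ε / 2) ^ j * u x) := by ring
        _ ≤ u (x - j * M - M) := h6.trans h5
        _ = u (x - (j + 1 : ℕ) * M) := by congr 1; push_cast; ring
  have h1 := key J le_rfl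
  have h2 := mul_lt_mul_of_pos_left hx (by positivity : 0 < (1 + ε / 2) ^ J)
  linarith

section Recursion

variable {Q : ℝ → ℝ} {κ m c θ : ℝ} {μ : Measure ℝ} [IsProbabilityMeasure μ] {u : ℕ → ℝ → ℝ}

/-- Values bounded away from zero grow close to one in boundedly many steps. -/
lemma IsBranchingFunction.exists_forward (hQ : IsBranchingFunction Q κ m c θ) (hκ : 0 < κ)
    (μ : Measure ℝ) [IsProbabilityMeasure μ] {δ e : ℝ} (hδ : 0 < δ) (hδ2 : δ ≤ 1 / 2)
    (he : 0 < e) (he2 : e ≤ 1 / 2) :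
    ∃ (r : ℕ) (B : ℝ), ∀ u : ℕ → ℝ → ℝ, (∀ n, MemD (u n)) →
      (∀ n x, u (n + 1) x = ∫ t, Q (u n (x - t)) ∂μ) →
      ∀ n x, δ < u n x → 1 - e ≤ u (n + r) (x - B) := by
  set γ := κ * (δ * e) with hγ
  have hγ0 : 0 < γ := by positivity
  obtain ⟨C, hC⟩ := ((memD_measureReal_Ioi μ).2.2.2.1.eventually
    (eventually_gt_nhds (by linarith : 1 - γ < 1))).exists
  obtain ⟨r, hr⟩ := exists_nat_gt (1 / γ)
  rw [div_lt_iff₀ hγ0] at hr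
  refine ⟨r, r * -C, fun u hu hrec n x hx => ?_⟩
  have key : ∀ j : ℕ, min (δ + j * γ) (1 - e) ≤ u (n + j) (x - j * -C) := by
    intro j
    induction j with
    | zero => simpa using Or.inl hx.le
    | succ j ih =>
      set l := min (δ + j * γ) (1 - e) with hl
      have hlδ : δ ≤ l := le_min (by have := j.cast_nonneg (α := ℝ); nlinarith) (by linarith)
      have hle : l ≤ 1 - e := min_le_right _ _
      have hlI : l ∈ Icc (0 : ℝ) 1 := ⟨by linarith, by linarith⟩
      set y := x - j * -C with hy
      have hyI := (hu (n + j)).2.2.1 y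
      have hw := hQ.memD_comp hκ.le (hu (n + j))
      have h1 := hQ.monotoneOn hlI hyI ih
      have h2 := hQ.lower l hlI
      have h3 : γ ≤ κ * (l * (1 - l)) := by
        refine mul_le_mul_of_nonneg_left ?_ hκ.le
        exact mul_le_mul hlδ (by linarith) he.le hlI.1
      have hint := fun z => hw.integrable_comp_sub μ z
      have h4 : μ.real (Ioi C) * Q (u (n + j) y) ≤ u (n + j + 1) (y + C) := by
        rw [hrec]
        refine le_trans ?_ (setIntegral_le_integral (s := Ioi C) (hint _)
          (Eventually.of_forall fun t => (hw.2.2.1 _).1))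
        rw [← smul_eq_mul, ← setIntegral_const]
        exact setIntegral_mono_on (integrable_const _).integrableOn (hint _).integrableOn
          measurableSet_Ioi fun t ht => hw.1 (by linarith [mem_Ioi.1 ht])
      have hQI := hQ.mem_Icc hκ.le hyI
      have h5 : Q (u (n + j) y) - γ ≤ μ.real (Ioi C) * Q (u (n + j) y) := by
        nlinarith [hQI.1, hQI.2]
      have h6 : min (δ + (j + 1 : ℕ) * γ) (1 - e) ≤ l + γ := by
        push_cast
        rcases le_total (δ + j * γ) (1 - e) with h | h
        · rw [hl, min_eq_left h]
          exact (min_le_left _ _).trans (by linarith)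
        · rw [hl, min_eq_right h]
          exact (min_le_right _ _).trans (by linarith)
      have h7 : x - (j + 1 : ℕ) * -C = y + C := by rw [hy]; push_cast; ring
      rw [h7, ← add_assoc]
      linarith
  have := key r
  rwa [min_eq_right (by linarith)] at this

/-- Values bounded away from zero come from values bounded away from zero at earlier times. -/
lemma IsBranchingFunction.exists_backward (hQ : IsBranchingFunction Q κ m c θ) (hκ : 0 < κ)
    (hm : 1 ≤ m) (hu : ∀ n, MemD (u n))
    (hrec : ∀ n x, u (n + 1) x = ∫ t, Q (u n (x - t)) ∂μ) (r : ℕ) :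
    ∀ δ : ℝ, 0 < δ → ∃ δ' B : ℝ, 0 < δ' ∧ ∀ n x, δ < u (n + r) x → δ' < u n (x - B) := by
  induction r with
  | zero => exact fun δ hδ => ⟨δ, 0, hδ, fun n x h => by simpa using h⟩
  | succ r ih =>
    intro δ hδ
    obtain ⟨B₁, hB₁⟩ := ((memD_measureReal_Ioi μ).2.2.2.2.eventually
      (eventually_lt_nhds (half_pos hδ))).exists
    obtain ⟨δ', B, hδ', hB⟩ := ih (δ / (2 * m)) (by positivity)
    refine ⟨δ', B₁ + B, hδ', fun n x hx => ?_⟩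
    rw [← sub_sub]
    refine hB n _ ?_
    rw [← add_assoc, hrec] at hx
    have hw := hQ.memD_comp hκ.le (hu (n + r))
    have hint := hw.integrable_comp_sub μ x
    rw [← integral_add_compl measurableSet_Iic (s := Iic B₁) hint, compl_Iic] at hx
    have h1 : ∫ t in Iic B₁, Q (u (n + r) (x - t)) ∂μ ≤ Q (u (n + r) (x - B₁)) := by
      have h2 : ∫ t in Iic B₁, Q (u (n + r) (x - t)) ∂μ ≤
          ∫ _t in Iic B₁, Q (u (n + r) (x - B₁)) ∂μ :=
        setIntegral_mono_on hint.integrableOn (integrable_const _).integrableOn measurableSet_Iic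
          fun t ht => hw.1 (by linarith [mem_Iic.1 ht])
      rw [setIntegral_const, smul_eq_mul] at h2
      exact h2.trans (mul_le_of_le_one_left (hw.2.2.1 _).1 measureReal_le_one)
    have h3 : ∫ t in Ioi B₁, Q (u (n + r) (x - t)) ∂μ ≤ μ.real (Ioi B₁) := by
      have h2 : ∫ t in Ioi B₁, Q (u (n + r) (x - t)) ∂μ ≤ ∫ _t in Ioi B₁, (1 : ℝ) ∂μ :=
        setIntegral_mono_on hint.integrableOn (integrable_const _).integrableOn measurableSet_Ioi
          fun t _ => (hw.2.2.1 _).2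
      simpa using h2
    have h4 := hQ.upper _ ((hu (n + r)).2.2.1 (x - B₁))
    rw [div_lt_iff₀ (by positivity)]
    linarith

/-- The transition window of the functions of a nonflat recursion has bounded width. -/
lemma IsBranchingFunction.exists_window (hQ : IsBranchingFunction Q κ m c θ) (hκ : 0 < κ)
    (hm : 1 ≤ m) (hu : ∀ n, MemD (u n))
    (hrec : ∀ n x, u (n + 1) x = ∫ t, Q (u n (x - t)) ∂μ) {ε D s M : ℝ} (hε : 0 < ε) (hD : 0 < D)
    (hs : 0 < s) (hM : 0 < M) (hflat : ∀ n, Nonflat ε D s M (u n)) {e : ℝ} (he : 0 < e)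
    (he2 : e ≤ 1 / 2) :
    ∃ B : ℝ, 0 ≤ B ∧ ∀ n x, e < u n x → 1 - e ≤ u n (x - B) := by
  obtain ⟨δ₀, hδ₀, hδ₀2, hshift⟩ := Nonflat.exists_shift hε hD hs hM
  obtain ⟨r, B₁, hB₁⟩ := hQ.exists_forward hκ μ hδ₀ hδ₀2 he he2
  obtain ⟨δ', B₂, hδ', hB₂⟩ := hQ.exists_backward hκ hm hu hrec r e he
  obtain ⟨B₃, hB₃⟩ := hshift δ' hδ'
  have hsingle : ∀ n, ∃ B : ℝ, 0 ≤ B ∧ ∀ x, e < u n x → 1 - e ≤ u n (x - B) := by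
    intro n
    obtain ⟨b, hb⟩ := ((hu n).2.2.2.2.eventually (eventually_lt_nhds he)).exists
    obtain ⟨l, hl⟩ := ((hu n).2.2.2.1.eventually
      (eventually_gt_nhds (by linarith : 1 - e < 1))).exists
    refine ⟨max (b - l) 0, le_max_right _ _, fun x hx => hl.le.trans ((hu n).1 ?_)⟩
    have hxb : x ≤ b := by
      by_contra h
      have := (hu n).1 (le_of_lt (not_le.1 h))
      linarith
    linarith [le_max_left (b - l) 0]
  choose b hb0 hb using hsingle
  have hsum : 0 ≤ ∑ n ∈ Finset.range r, b n := Finset.sum_nonneg fun n _ => hb0 n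
  refine ⟨max (B₂ + B₃ + B₁) (∑ n ∈ Finset.range r, b n), hsum.trans (le_max_right _ _),
    fun n x hx => ?_⟩
  rcases lt_or_ge n r with hn | hn
  · refine (hb n x hx).trans ((hu n).1 ?_)
    have := Finset.single_le_sum (fun i _ => hb0 i) (Finset.mem_range.2 hn)
    have := le_max_right (B₂ + B₃ + B₁) (∑ n ∈ Finset.range r, b n)
    linarith
  · obtain ⟨k, rfl⟩ := Nat.exists_eq_add_of_le' hn
    have h1 := hB₁ u hu hrec k _ (hB₃ _ (hu k) (hflat k) _ (hB₂ k x hx))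
    refine h1.trans ((hu _).1 ?_)
    have := le_max_left (B₂ + B₃ + B₁) (∑ n ∈ Finset.range r, b n)
    linarith

end Recursion

/-- A sequence whose transition windows have bounded widths is tight after centering. -/
lemma tightAfterCentering_of_window {u : ℕ → ℝ → ℝ} (hu : ∀ n, MemD (u n))
    (h : ∀ e : ℝ, 0 < e → e ≤ 1 / 2 →
      ∃ B : ℝ, 0 ≤ B ∧ ∀ n x, e < u n x → 1 - e ≤ u n (x - B)) :
    TightAfterCentering fun n x => 1 - u n x := by
  intro ε hε
  have he : 0 < min (ε / 3) (1 / 3) := by positivity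
  have heε := min_le_left (ε / 3) (1 / 3)
  have he3 := min_le_right (ε / 3) (1 / 3)
  generalize min (ε / 3) (1 / 3) = e at *
  obtain ⟨B, hB0, hB⟩ := h e he (by linarith)
  refine ⟨B + 1, by linarith, fun n => ?_⟩
  obtain ⟨hanti, -, -, hbot, htop⟩ := hu n
  have hne : {x | 1 / 2 ≤ 1 - u n x}.Nonempty := by
    obtain ⟨x, hx⟩ := (htop.eventually (eventually_lt_nhds (by norm_num : (0 : ℝ) < 1 / 2))).exists
    exact ⟨x, show 1 / 2 ≤ 1 - u n x by linarith⟩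
  have hbdd : BddBelow {x | 1 / 2 ≤ 1 - u n x} := by
    obtain ⟨l, hl⟩ := (hbot.eventually (eventually_gt_nhds (by norm_num : (1 / 2 : ℝ) < 1))).exists
    refine ⟨l, fun x hx => ?_⟩
    by_contra hlx
    have := hanti (le_of_lt (not_le.1 hlx))
    have hx' : 1 / 2 ≤ 1 - u n x := hx
    linarith
  change 1 - ε < (1 - u n (B + 1 + Med fun x => 1 - u n x)) -
    (1 - u n (-(B + 1) + Med fun x => 1 - u n x))
  set q := Med fun x => 1 - u n x with hq
  have hright : u n (B + 1 + q) ≤ e := by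
    by_contra hcon
    have h1 := hB n _ (not_le.1 hcon)
    obtain ⟨y, hy, hyq⟩ := exists_lt_of_csInf_lt hne (by rw [hq, Med]; linarith :
      sInf {x | 1 / 2 ≤ 1 - u n x} < q + 1)
    have h2 : u n (B + 1 + q - B) ≤ u n y := hanti (by linarith)
    have h3 : 1 / 2 ≤ 1 - u n y := hy
    linarith
  have hleft : e < u n (q - 1) := by
    by_contra hcon
    have h1 : q ≤ q - 1 := csInf_le hbdd
      (show 1 / 2 ≤ 1 - u n (q - 1) by linarith [not_lt.1 hcon])
    linarith
  have h1 := hB n _ hleft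
  rw [show q - 1 - B = -(B + 1) + q by ring] at h1
  linarith

/-- Theorem 1.1 (recursion form): for a branching random walk whose branching law
`{p_k}` satisfies `p₁ < 1` and the moment condition (1.17), and whose increment
distribution `G` satisfies the exponential-tail/nonflatness condition (1.16), the
distribution functions `Fₙ` of the maximal displacement, defined by
`F̄₀(x) = 1_{x<0}` and `F̄ₙ₊₁(x) = -∫ Ḡ(x-y) dQ(F̄ₙ(y))` with
`Q(u) = 1 - ∑ₖ p_k (1-u)^k`, are tight after centering. -/
theorem brw_maximal_displacement_tight
    (p : ℕ → ℝ) (hp0 : ∀ k, 0 ≤ p k) (hp00 : p 0 = 0)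
    (hpsum : ∑' k : ℕ, p k = 1) (hp1 : p 1 < 1)
    (θ : ℝ) (hθ1 : 1 < θ) (hθ2 : θ ≤ 2)
    (hmθ : Summable fun k : ℕ => (k : ℝ) ^ θ * p k)
    (G : ℝ → ℝ) (hGD : MemD fun x => 1 - G x)
    (a M₀ : ℝ) (ha : 0 < a) (hM₀ : 0 < M₀)
    (htail : ∀ x M : ℝ, 0 ≤ x → M₀ ≤ M →
      1 - G (x + M) ≤ Real.exp (-(a * M)) * (1 - G x))
    (Fbar : ℕ → ℝ → ℝ)
    (hF0 : ∀ x : ℝ, Fbar 0 x = if x < 0 then 1 else 0)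
    (hrec : ∀ (n : ℕ) (x : ℝ), Fbar (n + 1) x =
      ∫ y, (1 - G (x - y))
        ∂(lsMeasure fun y => 1 - ∑' k : ℕ, p k * (1 - Fbar n y) ^ k)) :
    TightAfterCentering (fun n x => 1 - Fbar n x) := by
  obtain ⟨m, c, hm, hc, hQ⟩ := isBranchingFunction p hp0 hp00 hpsum θ hθ1 hθ2 hmθ
  obtain ⟨hμ, hμG⟩ := hGD.lsMeasure_spec
  set μ := lsMeasure fun x => 1 - G x
  simp only [← hμG] at htail hrec
  have hp1' : 0 ≤ p 1 := hp0 1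
  have hκ : 0 < (1 - p 1) / 2 := by linarith
  obtain ⟨ε, D, M, hε, hεD, hM, hstep⟩ := hQ.exists_nonflat_step hκ (by linarith) hm hc hθ1 hθ2
    ha hM₀ htail
  set Q : ℝ → ℝ := fun u => 1 - ∑' k : ℕ, p k * (1 - u) ^ k with hQdef
  have hmem0 : MemD (Fbar 0) := by
    convert memD_measureReal_Ioi (Measure.dirac 0) using 1
    funext x
    rw [hF0, measureReal_def, Measure.dirac_apply' _ measurableSet_Ioi]
    by_cases hx : x < 0 <;> simp [hx]
  have hrec' : ∀ n, MemD (Fbar n) → ∀ x, Fbar (n + 1) x = ∫ t, Q (Fbar n (x - t)) ∂μ :=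
    fun n hn x => (hrec n x).trans (((hQ.memD_comp hκ.le hn).convolution μ).1 x)
  have hmem : ∀ n, MemD (Fbar n) := by
    intro n
    induction n with
    | zero => exact hmem0
    | succ n ih =>
      have := ((hQ.memD_comp hκ.le ih).convolution μ).2
      rwa [← funext (hrec' n ih)] at this
  have hflat : ∀ n, Nonflat ε D (θ - 1) M (Fbar n) := by
    intro n
    induction n with
    | zero =>
      intro x
      rw [hF0, hF0]
      by_cases hx : x < 0
      · rw [if_pos hx, if_pos (by linarith), Real.one_rpow]
        linarith
      · rw [if_neg hx, mul_zero]
        split_ifs <;> norm_num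
    | succ n ih =>
      have := hstep _ (hmem n) ih
      rwa [← funext (hrec' n (hmem n))] at this
  exact tightAfterCentering_of_window hmem fun e he he2 =>
    hQ.exists_window hκ hm hmem (fun n => hrec' n (hmem n)) hε (by linarith) (by linarith) hM hflat
      he he2
end
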